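/- arXiv:1509.08179 — 3 statements merged into one kernel-verified Lean document; each statement's English description precedes it below -/
import Mathlib

section
/- Assume (A0) and (A2) with exponent $\gamma>1$. Let $(a,\rho)$ be a solution of the Friedmann system on $[t_0,+\infty)$ such that $a(t)\to+\infty$, $\rho(t)\to 0$, and $a'(t)>0$ for all $t\ge t_0$. Then the limits $a_1:=\lim_{t\to+\infty} e^{-c\sqrt{\Lambda/3}\,t}\,a(t)$ and $\rho_1:=\lim_{t\to+\infty} a(t)^3\rho(t)$ exist and are positive real numbers, and $\lim_{t\to+\infty} e^{3c\sqrt{\Lambda/3}\,t}\,\rho(t)=\rho_1 a_1^{-3}$. -/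
open Real Filter Set Topology Asymptotics

/-- Assumption (A0): `P` is a smooth function of `ρ > 0` with `0 ≤ P`,
`0 ≤ dP/dρ < c²` for `ρ > 0`, and `P → 0` as `ρ → 0⁺`. -/
def A0 (c : ℝ) (P : ℝ → ℝ) : Prop :=
  ContDiffOn ℝ (⊤ : ℕ∞) P (Set.Ioi 0) ∧
  (∀ ρ > (0 : ℝ), 0 ≤ P ρ) ∧
  (∀ ρ > (0 : ℝ), 0 ≤ deriv P ρ ∧ deriv P ρ < c ^ 2) ∧
  Filter.Tendsto P (nhdsWithin 0 (Set.Ioi 0)) (nhds 0)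

/-- A solution of the Friedmann system on a set `I`: `a > 0`, `ρ > 0`,
`a'' = (-(4πG/3)(ρ + 3P(ρ)/c²) + c²Λ/3) a` and `ρ' = -3(ρ + P(ρ)/c²) a'/a`. -/
def IsFriedmannSolution (c G Λ : ℝ) (P : ℝ → ℝ) (a ρ : ℝ → ℝ) (I : Set ℝ) : Prop :=
  ∀ t ∈ I, 0 < a t ∧ 0 < ρ t ∧
    DifferentiableAt ℝ a t ∧
    HasDerivAt (deriv a)
      ((-(4 * Real.pi * G / 3) * (ρ t + 3 * P (ρ t) / c ^ 2) + c ^ 2 * Λ / 3) * a t) t ∧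
    HasDerivAt ρ (-3 * (ρ t + P (ρ t) / c ^ 2) * (deriv a t / a t)) t

/-- Assumption (A2): there is `γ > 1` with `P(ρ) = O(ρ^γ)` as `ρ → 0⁺`. -/
def A2 (P : ℝ → ℝ) (γ : ℝ) : Prop :=
  1 < γ ∧ P =O[nhdsWithin 0 (Set.Ioi 0)] fun ρ : ℝ => ρ ^ γ

/-- A function whose derivative is dominated by the derivative of a convergent function
converges at infinity. -/
theorem exists_tendsto_atTop_of_abs_hasDerivAt_le {f f' F F' : ℝ → ℝ} {T l : ℝ}
    (hf : ∀ t, T ≤ t → HasDerivAt f (f' t) t) (hF : ∀ t, T ≤ t → HasDerivAt F (F' t) t)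
    (hle : ∀ t, T ≤ t → |f' t| ≤ F' t) (hl : Tendsto F atTop (𝓝 l)) :
    ∃ m, Tendsto f atTop (𝓝 m) := by
  have hF' : MeasureTheory.IntegrableOn F' (Ioi T) :=
    MeasureTheory.integrableOn_Ioi_deriv_of_nonneg (hF T le_rfl).continuousAt.continuousWithinAt
      (fun t ht => hF t (le_of_lt ht)) (fun t ht => (abs_nonneg _).trans (hle t (le_of_lt ht))) hl
  have hmeas : MeasureTheory.AEStronglyMeasurable f'
      (MeasureTheory.volume.restrict (Ioi T)) := by
    refine (measurable_deriv f).aestronglyMeasurable.congr ?_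
    filter_upwards [MeasureTheory.ae_restrict_mem measurableSet_Ioi] with t ht
    exact (hf t (le_of_lt ht)).deriv
  have hf' : MeasureTheory.IntegrableOn f' (Ioi T) := by
    refine MeasureTheory.Integrable.mono' hF' hmeas ?_
    filter_upwards [MeasureTheory.ae_restrict_mem measurableSet_Ioi] with t ht
    exact hle t (le_of_lt ht)
  exact ⟨_, MeasureTheory.tendsto_limUnder_of_hasDerivAt_of_integrableOn_Ioi
    (fun t ht => hf t (le_of_lt ht)) hf'⟩

/-- A function whose derivative is `O((a'/a) a⁻ᵐ)` along a function `a` growing to infinity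
converges. -/
theorem exists_tendsto_atTop_of_abs_hasDerivAt_le_rpow {f f' a : ℝ → ℝ} {C m : ℝ} (hm : 0 < m)
    (ha : Tendsto a atTop atTop)
    (h : ∀ᶠ t in atTop, 0 < a t ∧ DifferentiableAt ℝ a t ∧ HasDerivAt f (f' t) t ∧
      |f' t| ≤ C * (deriv a t / a t) * a t ^ (-m)) :
    ∃ l, Tendsto f atTop (𝓝 l) := by
  obtain ⟨T, hT⟩ := eventually_atTop.1 h
  have hF : Tendsto (fun t => (-C / m) * a t ^ (-m)) atTop (𝓝 ((-C / m) * 0)) :=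
    ((tendsto_rpow_neg_atTop hm).comp ha).const_mul _
  refine exists_tendsto_atTop_of_abs_hasDerivAt_le (fun t ht => (hT t ht).2.2.1)
    (fun t ht => ?_) (fun t ht => (hT t ht).2.2.2) hF
  obtain ⟨hpos, hd, -, -⟩ := hT t ht
  have := (hd.hasDerivAt.rpow_const (p := -m) (Or.inl hpos.ne')).const_mul (-C / m)
  refine this.congr_deriv ?_
  rw [Real.rpow_sub_one hpos.ne']
  field_simp

section Friedmann

variable {c G Λ t0 : ℝ} {P a ρ : ℝ → ℝ}

/-- The Friedmann energy `a'² - (8πG/3) ρ a² - (c²Λ/3) a²` is conserved. -/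
theorem IsFriedmannSolution.energy_eq (hsol : IsFriedmannSolution c G Λ P a ρ (Ici t0)) {t : ℝ}
    (ht : t0 ≤ t) :
    deriv a t ^ 2 - (8 * π * G / 3 * ρ t + c ^ 2 * Λ / 3) * a t ^ 2 =
      deriv a t0 ^ 2 - (8 * π * G / 3 * ρ t0 + c ^ 2 * Λ / 3) * a t0 ^ 2 := by
  have hd : ∀ s ∈ Ici t0, HasDerivWithinAt
      (fun s => deriv a s ^ 2 - (8 * π * G / 3 * ρ s + c ^ 2 * Λ / 3) * a s ^ 2) 0 (Ici t0) s := by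
    intro s hs
    obtain ⟨hapos, -, had, hadd, hρd⟩ := hsol s hs
    have := (hadd.pow 2).sub
      (((hρd.const_mul (8 * π * G / 3)).add_const (c ^ 2 * Λ / 3)).mul (had.hasDerivAt.pow 2))
    refine HasDerivAt.hasDerivWithinAt (this.congr_deriv ?_)
    simp
    field_simp
    ring
  have := (convex_Ici t0).norm_image_sub_le_of_norm_hasDerivWithin_le hd (C := 0) (by simp)
    self_mem_Ici ht
  rw [zero_mul, norm_le_zero_iff, sub_eq_zero] at this
  exact this

theorem IsFriedmannSolution.hasDerivAt_log_mass
    (hsol : IsFriedmannSolution c G Λ P a ρ (Ici t0)) {t : ℝ} (ht : t0 ≤ t) :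
    HasDerivAt (fun t => Real.log (a t ^ 3 * ρ t))
      (-3 * (P (ρ t) / c ^ 2 / ρ t) * (deriv a t / a t)) t := by
  obtain ⟨hapos, hρpos, had, -, hρd⟩ := hsol t ht
  have := ((had.hasDerivAt.pow 3).mul hρd).log (mul_pos (pow_pos hapos 3) hρpos).ne'
  refine this.congr_deriv ?_
  simp
  field_simp
  ring

/-- In an expanding solution the mass `a³ρ` is bounded by its initial value. -/
theorem IsFriedmannSolution.mass_le (hsol : IsFriedmannSolution c G Λ P a ρ (Ici t0))
    (hP : ∀ r > 0, 0 ≤ P r) (ha' : ∀ t, t0 ≤ t → 0 < deriv a t) {t : ℝ} (ht : t0 ≤ t) :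
    a t ^ 3 * ρ t ≤ a t0 ^ 3 * ρ t0 := by
  have hpos : ∀ s, t0 ≤ s → 0 < a s ^ 3 * ρ s := fun s hs =>
    mul_pos (pow_pos (hsol s hs).1 3) (hsol s hs).2.1
  have hanti : AntitoneOn (fun t => Real.log (a t ^ 3 * ρ t)) (Ici t0) := by
    refine antitoneOn_of_hasDerivWithinAt_nonpos (convex_Ici t0)
      (fun s hs => (hsol.hasDerivAt_log_mass hs).continuousAt.continuousWithinAt)
      (fun s hs => (hsol.hasDerivAt_log_mass (interior_subset hs)).hasDerivWithinAt)
      (fun s hs => ?_)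
    have hs' : t0 ≤ s := interior_subset hs
    have h1 := (hsol s hs').1
    have h2 := (hsol s hs').2.1
    have h3 := hP _ h2
    have h4 := ha' s hs'
    have : 0 ≤ (P (ρ s) / c ^ 2 / ρ s) * (deriv a s / a s) := by positivity
    linarith
  exact (Real.log_le_log_iff (hpos t ht) (hpos t0 le_rfl)).1 (hanti self_mem_Ici ht ht)

/-- In an expanding solution with `a → ∞`, the mass `a³ρ` has a positive limit. -/
theorem IsFriedmannSolution.exists_tendsto_mass {γ : ℝ}
    (hsol : IsFriedmannSolution c G Λ P a ρ (Ici t0)) (hP : ∀ r > 0, 0 ≤ P r) (hA2 : A2 P γ)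
    (ha : Tendsto a atTop atTop) (hρ : Tendsto ρ atTop (𝓝 0))
    (ha' : ∀ t, t0 ≤ t → 0 < deriv a t) :
    ∃ ρ1, 0 < ρ1 ∧ Tendsto (fun t => a t ^ 3 * ρ t) atTop (𝓝 ρ1) := by
  obtain ⟨hγ, hO⟩ := hA2
  obtain ⟨B, hB, hBO⟩ := hO.exists_pos
  have hρ' : Tendsto ρ atTop (𝓝[>] 0) := tendsto_nhdsWithin_iff.2
    ⟨hρ, (eventually_ge_atTop t0).mono fun t ht => (hsol t ht).2.1⟩
  set D := a t0 ^ 3 * ρ t0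
  have hD : 0 < D := mul_pos (pow_pos (hsol t0 self_mem_Ici).1 3) (hsol t0 self_mem_Ici).2.1
  obtain ⟨l, hl⟩ := exists_tendsto_atTop_of_abs_hasDerivAt_le_rpow
    (f := fun t => Real.log (a t ^ 3 * ρ t))
    (C := 3 * (B / c ^ 2) * D ^ (γ - 1)) (m := 3 * (γ - 1)) (by linarith) ha (by
      filter_upwards [eventually_ge_atTop t0, hρ'.eventually hBO.bound] with t ht hbound
      obtain ⟨hapos, hρpos, had, -, -⟩ := hsol t ht
      refine ⟨hapos, had, hsol.hasDerivAt_log_mass ht, ?_⟩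
      have hP0 := hP _ hρpos
      have hh : 0 < deriv a t / a t := div_pos (ha' t ht) hapos
      rw [Real.norm_of_nonneg hP0, Real.norm_of_nonneg (by positivity)] at hbound
      have hPρ : P (ρ t) / ρ t ≤ B * ρ t ^ (γ - 1) := by
        rw [Real.rpow_sub_one hρpos.ne', ← mul_div_assoc]
        gcongr
      have hρle : ρ t ≤ D * a t ^ (-3 : ℝ) := by
        rw [Real.rpow_neg hapos.le, ← div_eq_mul_inv, le_div_iff₀ (by positivity)]
        have := hsol.mass_le hP ha' ht
        norm_cast
        linarith
      have hρpow : ρ t ^ (γ - 1) ≤ D ^ (γ - 1) * a t ^ (-(3 * (γ - 1))) := by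
        calc ρ t ^ (γ - 1) ≤ (D * a t ^ (-3 : ℝ)) ^ (γ - 1) :=
              Real.rpow_le_rpow hρpos.le hρle (by linarith)
          _ = _ := by
              rw [Real.mul_rpow hD.le (by positivity), ← Real.rpow_mul hapos.le]
              ring_nf
      have habs : |(-3 * (P (ρ t) / c ^ 2 / ρ t) * (deriv a t / a t))| =
          3 / c ^ 2 * (deriv a t / a t) * (P (ρ t) / ρ t) := by
        rw [abs_mul, abs_mul, abs_of_pos hh, abs_of_nonneg (by positivity : 0 ≤ P (ρ t) / c ^ 2 / ρ t)]
        norm_num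
        ring
      rw [habs]
      calc 3 / c ^ 2 * (deriv a t / a t) * (P (ρ t) / ρ t)
          ≤ 3 / c ^ 2 * (deriv a t / a t) * (B * (D ^ (γ - 1) * a t ^ (-(3 * (γ - 1))))) := by
            gcongr
            exact hPρ.trans (by gcongr)
        _ = _ := by ring)
  refine ⟨Real.exp l, Real.exp_pos l, ((Real.continuous_exp.tendsto l).comp hl).congr' ?_⟩
  filter_upwards [eventually_ge_atTop t0] with t ht
  exact Real.exp_log (mul_pos (pow_pos (hsol t ht).1 3) (hsol t ht).2.1)

/-- In an expanding solution with `a → ∞`, the scale factor is asymptotic to a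
multiple of `exp (H t)`, where `H² = c²Λ/3`. -/
theorem IsFriedmannSolution.exists_tendsto_scale {H : ℝ} (hG : 0 < G) (hH : 0 < H)
    (hH2 : H ^ 2 = c ^ 2 * Λ / 3)
    (hsol : IsFriedmannSolution c G Λ P a ρ (Ici t0)) (hP : ∀ r > 0, 0 ≤ P r)
    (ha : Tendsto a atTop atTop) (ha' : ∀ t, t0 ≤ t → 0 < deriv a t) :
    ∃ a1, 0 < a1 ∧ Tendsto (fun t => Real.exp (-H * t) * a t) atTop (𝓝 a1) := by
  set D := a t0 ^ 3 * ρ t0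
  set E := deriv a t0 ^ 2 - (8 * π * G / 3 * ρ t0 + c ^ 2 * Λ / 3) * a t0 ^ 2 with hE
  set M := 8 * π * G / 3 * D + |E|
  obtain ⟨l, hl⟩ := exists_tendsto_atTop_of_abs_hasDerivAt_le_rpow
    (f := fun t => Real.log (a t) - H * t) (f' := fun t => deriv a t / a t - H)
    (C := M * (2 / H ^ 2)) (m := 2) two_pos ha (by
      have ha2 : Tendsto (fun t => a t ^ 2) atTop atTop :=
        (tendsto_pow_atTop two_ne_zero).comp ha
      filter_upwards [eventually_ge_atTop t0, ha.eventually_ge_atTop 1,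
        ha2.eventually_ge_atTop (M / (3 / 4 * H ^ 2))] with t ht ha1 haM
      obtain ⟨hapos, hρpos, had, -, -⟩ := hsol t ht
      refine ⟨hapos, had,
        ((had.hasDerivAt.log hapos.ne').sub ((hasDerivAt_id t).const_mul H)).congr_deriv (by simp),
        ?_⟩
      set h := deriv a t / a t with hh
      have hhpos : 0 < h := div_pos (ha' t ht) hapos
      have hda : deriv a t = h * a t := by rw [hh]; field_simp
      have hen := hsol.energy_eq ht
      rw [← hE, ← hH2, hda] at hen
      have hmass := hsol.mass_le hP ha' ht
      have hρa : a t ^ 2 * ρ t ≤ D := by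
        refine le_trans ?_ hmass
        exact mul_le_mul_of_nonneg_right (pow_le_pow_right₀ ha1 (by norm_num)) hρpos.le
      have hsq : |(h - H) * (h + H)| * a t ^ 2 ≤ M := by
        rw [← abs_of_pos (pow_pos hapos 2), ← abs_mul]
        have : (h - H) * (h + H) * a t ^ 2 = 8 * π * G / 3 * (a t ^ 2 * ρ t) + E := by
          linear_combination hen
        rw [this]
        refine (abs_add_le _ _).trans ?_
        rw [abs_of_nonneg (by positivity)]
        exact add_le_add (mul_le_mul_of_nonneg_left hρa (by positivity)) le_rfl
      have hlow : H ^ 2 / 4 ≤ h ^ 2 := by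
        rw [div_le_iff₀ (by positivity)] at haM
        have h1 : |(h - H) * (h + H)| ≤ 3 / 4 * H ^ 2 :=
          le_of_mul_le_mul_right (by linarith) (pow_pos hapos 2)
        linarith [neg_abs_le ((h - H) * (h + H))]
      have hhalf : H / 2 ≤ h := by
        refine le_of_sq_le_sq ?_ hhpos.le
        linarith
      have hprod : 1 ≤ 2 / H ^ 2 * (h * (h + H)) := by
        rw [div_mul_eq_mul_div, one_le_div (by positivity)]
        nlinarith
      rw [abs_mul, abs_of_pos (by positivity : 0 < h + H)] at hsq
      have hneg : a t ^ (-2 : ℝ) = 1 / a t ^ 2 := by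
        rw [Real.rpow_neg hapos.le]
        norm_num
      rw [hneg, mul_one_div, le_div_iff₀ (by positivity)]
      calc |h - H| * a t ^ 2 ≤ |h - H| * a t ^ 2 * (2 / H ^ 2 * (h * (h + H))) :=
            le_mul_of_one_le_right (by positivity) hprod
        _ = (|h - H| * (h + H) * a t ^ 2) * (2 / H ^ 2 * h) := by ring
        _ ≤ M * (2 / H ^ 2 * h) := by gcongr
        _ = _ := by ring)
  refine ⟨Real.exp l, Real.exp_pos l, ((Real.continuous_exp.tendsto l).comp hl).congr' ?_⟩
  filter_upwards [eventually_ge_atTop t0] with t ht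
  simp only [Function.comp_apply]
  rw [sub_eq_neg_add, Real.exp_add, Real.exp_log (hsol t ht).1, neg_mul]

end Friedmann

/-- Under (A0) and (A2), for an eventually expanding solution with `a → +∞`, `ρ → 0`,
the limits `a₁ = lim e^{-c√(Λ/3) t} a(t)` and `ρ₁ = lim a(t)³ ρ(t)` exist and are
positive, and `e^{3c√(Λ/3) t} ρ(t) → ρ₁ a₁⁻³`. -/
theorem expanding_asymptotics
    (c G Λ : ℝ) (hc : 0 < c) (hG : 0 < G) (hΛ : 0 < Λ)
    (P : ℝ → ℝ) (hA0 : A0 c P) (γ : ℝ) (hA2 : A2 P γ)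
    (t0 : ℝ) (a ρ : ℝ → ℝ)
    (hsol : IsFriedmannSolution c G Λ P a ρ (Set.Ici t0))
    (ha : Filter.Tendsto a Filter.atTop Filter.atTop)
    (hρ : Filter.Tendsto ρ Filter.atTop (nhds 0))
    (ha' : ∀ t : ℝ, t0 ≤ t → 0 < deriv a t) :
    ∃ a1 ρ1 : ℝ, 0 < a1 ∧ 0 < ρ1 ∧
      Filter.Tendsto (fun t => Real.exp (-(c * Real.sqrt (Λ / 3)) * t) * a t)
        Filter.atTop (nhds a1) ∧
      Filter.Tendsto (fun t => a t ^ 3 * ρ t) Filter.atTop (nhds ρ1) ∧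
      Filter.Tendsto (fun t => Real.exp (3 * c * Real.sqrt (Λ / 3) * t) * ρ t)
        Filter.atTop (nhds (ρ1 / a1 ^ 3)) := by
  have hH : 0 < c * Real.sqrt (Λ / 3) := mul_pos hc (Real.sqrt_pos.2 (by positivity))
  have hH2 : (c * Real.sqrt (Λ / 3)) ^ 2 = c ^ 2 * Λ / 3 := by
    rw [mul_pow, Real.sq_sqrt (by positivity), mul_div_assoc]
  obtain ⟨a1, ha1, hlima⟩ := hsol.exists_tendsto_scale hG hH hH2 hA0.2.1 ha ha'
  obtain ⟨ρ1, hρ1, hlimρ⟩ := hsol.exists_tendsto_mass hA0.2.1 hA2 ha hρ ha'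
  refine ⟨a1, ρ1, ha1, hρ1, hlima, hlimρ, (hlimρ.div (hlima.pow 3) (by positivity)).congr' ?_⟩
  filter_upwards [eventually_ge_atTop t0] with t ht
  have hapos := (hsol t ht).1
  simp only [Pi.div_apply]
  rw [mul_pow, ← Real.exp_nat_mul,
    show 3 * c * Real.sqrt (Λ / 3) * t = -((3 : ℕ) * (-(c * Real.sqrt (Λ / 3)) * t)) by
      push_cast; ring, Real.exp_neg]
  field_simp
end

section
/- (Corollary 3.) Assume (A0), and let $a_0>0$, $\rho_0>0$ satisfy $4\pi G(\rho_0+3P(\rho_0)/c^2)>c^2\Lambda$. Then there exists $\epsilon>0$, depending on $a_0$ and $\rho_0$, such that for every $\dot a_0$ with $0<\dot a_0\le\epsilon$, the solution $(a,\rho)$ of the Friedmann system with initial data $a(0)=a_0$, $a'(0)=\dot a_0$, $\rho(0)=\rho_0$, on its maximal interval of existence $]t_-,t_+[$ in $\{a>0,\ \rho>0\}$, satisfies: $t_+<+\infty$, and $a(t)\to 0$ and $\rho(t)\to+\infty$ as $t\to t_+-0$. -/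
open Real Filter Set Topology

/-- `(a, ρ)` is a solution of the Friedmann system on the maximal interval of existence
`]t₋, t₊[` (with `-∞ ≤ t₋ < 0 < t₊ ≤ +∞`) in the domain `{a > 0, ρ > 0}`: the solution
property holds on `]t₋, t₊[`, and any solution with the same initial data at `t = 0`
is defined on a subinterval of `]t₋, t₊[`. -/
def IsMaximalSolution (c G Λ : ℝ) (P : ℝ → ℝ) (a ρ : ℝ → ℝ) (tm tp : EReal) : Prop :=
  tm < (0 : EReal) ∧ (0 : EReal) < tp ∧
  IsFriedmannSolution c G Λ P a ρ {t : ℝ | tm < (t : EReal) ∧ (t : EReal) < tp} ∧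
  ∀ (b σ : ℝ → ℝ) (s u : ℝ), s < 0 → 0 < u →
    IsFriedmannSolution c G Λ P b σ (Set.Ioo s u) →
    b 0 = a 0 → deriv b 0 = deriv a 0 → σ 0 = ρ 0 →
    tm ≤ (s : EReal) ∧ (u : EReal) ≤ tp

/-- Two curves meeting with equal velocities glue to a differentiable curve. -/
theorem hasDerivAt_ite_le {E : Type*} [NormedAddCommGroup E] [NormedSpace ℝ E]
    {f g : ℝ → E} {f' : E} {s : ℝ} (hf : HasDerivAt f f' s) (hg : HasDerivAt g f' s)
    (h : f s = g s) : HasDerivAt (fun t => if t ≤ s then f t else g t) f' s := by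
  have h₁ : HasDerivWithinAt (fun t => if t ≤ s then f t else g t) f' (Iic s) s :=
    hf.hasDerivWithinAt.congr (fun t ht => if_pos ht) (if_pos le_rfl)
  have h₂ : HasDerivWithinAt (fun t => if t ≤ s then f t else g t) f' (Ici s) s := by
    refine hg.hasDerivWithinAt.congr (fun t ht => ?_) (by simpa using h)
    rcases eq_or_lt_of_le (mem_Ici.1 ht) with rfl | hlt
    · simpa using h
    · exact if_neg (not_le.2 hlt)
  exact (h₁.union h₂).hasDerivAt (by simp [Iic_union_Ici])

/-- The local flow of a `C¹` vector field exists for a uniform time and stays in a prescribed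
neighbourhood, for all initial values close to a given point. -/
theorem exists_uniform_local_solution {E : Type*} [NormedAddCommGroup E] [NormedSpace ℝ E]
    [CompleteSpace E] {v : E → E} {x₀ : E} (hv : ContDiffAt ℝ 1 v x₀) {U : Set E}
    (hU : U ∈ 𝓝 x₀) :
    ∃ V ∈ 𝓝 x₀, ∃ ε > (0 : ℝ), ∀ x ∈ V, ∃ α : ℝ → E, α 0 = x ∧
      ∀ t ∈ Ioo (-ε) ε, HasDerivAt α (v (α t)) t ∧ α t ∈ U := by
  obtain ⟨ε, hε, _, r, _, _, hr, hpl⟩ := IsPicardLindelof.of_contDiffAt_one hv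
  obtain ⟨α, hα, hcont⟩ :=
    (hpl 0).exists_forall_mem_closedBall_eq_hasDerivWithinAt_continuousOn
  have hball : Metric.closedBall x₀ (r : ℝ) ∈ 𝓝 x₀ := Metric.closedBall_mem_nhds _ (by simpa)
  have hIcc : Icc (0 - ε) (0 + ε) ∈ 𝓝 (0 : ℝ) := Icc_mem_nhds (by linarith) (by linarith)
  have hca : ContinuousAt α (x₀, 0) := hcont.continuousAt (prod_mem_nhds hball hIcc)
  have hα₀ : α (x₀, 0) = x₀ := (hα x₀ (mem_of_mem_nhds hball)).1
  have hpre : α ⁻¹' U ∈ 𝓝 (x₀, (0 : ℝ)) := hca (by rwa [hα₀])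
  obtain ⟨V, hV, W, hW, hVW⟩ := mem_nhds_prod_iff.1 hpre
  obtain ⟨δ, hδ, hδW⟩ := Metric.mem_nhds_iff.1 hW
  refine ⟨V ∩ Metric.closedBall x₀ r, inter_mem hV hball, min ε δ, lt_min hε hδ,
    fun x hx => ⟨fun t => α (x, t), (hα x hx.2).1, fun t ht => ⟨?_, ?_⟩⟩⟩
  · have h₁ : -ε < t := by linarith [ht.1, min_le_left ε δ]
    have h₂ : t < ε := ht.2.trans_le (min_le_left _ _)
    exact ((hα x hx.2).2 t ⟨by linarith, by linarith⟩).hasDerivAt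
      (Icc_mem_nhds (by linarith) (by linarith))
  · refine hVW ⟨hx.1, hδW ?_⟩
    rw [Real.ball_eq_Ioo]
    exact ⟨by linarith [ht.1, min_le_right ε δ], by linarith [ht.2, min_le_right ε δ]⟩

/-- An integral curve that stays in a compact subset of the domain up to a finite time `T`
extends beyond `T`. -/
theorem exists_extension_of_mem_isCompact {E : Type*} [NormedAddCommGroup E] [NormedSpace ℝ E]
    [CompleteSpace E] {v : E → E} {U K : Set E} (hU : IsOpen U) (hK : IsCompact K) (hKU : K ⊆ U)
    (hv : ∀ x ∈ U, ContDiffAt ℝ 1 v x) {x : ℝ → E} {s τ T : ℝ} (hτT : τ < T)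
    (hx : ∀ t ∈ Ioo s T, HasDerivAt x (v (x t)) t ∧ x t ∈ U) (hxK : ∀ t ∈ Ioo τ T, x t ∈ K) :
    ∃ u > T, ∃ y : ℝ → E, (∀ t ∈ Ioo s u, HasDerivAt y (v (y t)) t ∧ y t ∈ U) ∧
      ∀ t ≤ τ, y t = x t := by
  obtain ⟨p, hpK, hp⟩ := hK.exists_mapClusterPt (f := 𝓝[<] T) (u := x) (by
    rw [le_principal_iff, mem_map]
    exact mem_of_superset (Ioo_mem_nhdsLT hτT) hxK)
  obtain ⟨V, hV, ε, hε, hflow⟩ :=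
    exists_uniform_local_solution (hv p (hKU hpK)) (hU.mem_nhds (hKU hpK))
  have hfreq : ∃ᶠ t in 𝓝[<] T, x t ∈ V := mapClusterPt_iff_frequently.1 hp V hV
  have hev : Ioo (max τ (T - ε)) T ∈ 𝓝[<] T := Ioo_mem_nhdsLT (max_lt hτT (by linarith))
  obtain ⟨r, hrV, hr⟩ := (hfreq.and_eventually hev).exists
  obtain ⟨α, hα₀, hα⟩ := hflow _ hrV
  have hτr : τ < r := (le_max_left _ _).trans_lt hr.1
  have hTr : T - ε < r := (le_max_right _ _).trans_lt hr.1
  have hd (t : ℝ) (h₁ : r - ε < t) (h₂ : t < r + ε) :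
      HasDerivAt (fun t => α (t - r)) (v (α (t - r))) t ∧ α (t - r) ∈ U := by
    have := hα (t - r) ⟨by linarith, by linarith⟩
    exact ⟨this.1.comp_sub_const t r, this.2⟩
  refine ⟨r + ε, by linarith, fun t => if t ≤ r then x t else α (t - r), fun t ht => ?_,
    fun t ht => if_pos (ht.trans hτr.le)⟩
  rcases lt_trichotomy t r with h | rfl | h
  · have := hx t ⟨ht.1, h.trans hr.2⟩
    simp only [if_pos h.le]
    refine ⟨this.1.congr_of_eventuallyEq ?_, this.2⟩
    filter_upwards [Iio_mem_nhds h] with w hw using if_pos (le_of_lt hw)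
  · have h₁ := hx t ⟨ht.1, hr.2⟩
    have h₂ := hd t (by linarith) (by linarith)
    simp only [le_refl, if_true]
    refine ⟨hasDerivAt_ite_le h₁.1 ?_ (by simp [hα₀]), h₁.2⟩
    simpa [hα₀] using h₂.1
  · have := hd t (by linarith) ht.2
    simp only [if_neg (not_le.2 h)]
    refine ⟨this.1.congr_of_eventuallyEq ?_, this.2⟩
    filter_upwards [Ioi_mem_nhds h] with w hw using if_neg (not_le.2 hw)

/-- The Friedmann system as a first order vector field for the scale factor, its velocity
and the density. -/
noncomputable def friedmannField (c G Λ : ℝ) (P : ℝ → ℝ) (x : ℝ × ℝ × ℝ) : ℝ × ℝ × ℝ :=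
  (x.2.1,
    (-(4 * Real.pi * G / 3) * (x.2.2 + 3 * P x.2.2 / c ^ 2) + c ^ 2 * Λ / 3) * x.1,
    -3 * (x.2.2 + P x.2.2 / c ^ 2) * (x.2.1 / x.1))

section

variable {c G Λ : ℝ} {P a ρ : ℝ → ℝ}

theorem A0.contDiffAt_friedmannField (hA0 : A0 c P) {x : ℝ × ℝ × ℝ} (h₁ : 0 < x.1)
    (h₂ : 0 < x.2.2) : ContDiffAt ℝ 1 (friedmannField c G Λ P) x := by
  have hP : ContDiffAt ℝ 1 P x.2.2 :=
    (hA0.1.contDiffAt (Ioi_mem_nhds h₂)).of_le (by exact_mod_cast le_top)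
  have hPx : ContDiffAt ℝ 1 (fun y : ℝ × ℝ × ℝ => P y.2.2) x :=
    ContDiffAt.comp x hP (by fun_prop)
  have hq : ContDiffAt ℝ 1 (fun y : ℝ × ℝ × ℝ => y.2.1 / y.1) x :=
    ContDiffAt.div (by fun_prop) (by fun_prop) h₁.ne'
  unfold friedmannField
  fun_prop

theorem IsFriedmannSolution.mono {I J : Set ℝ} (h : IsFriedmannSolution c G Λ P a ρ I)
    (hJ : J ⊆ I) : IsFriedmannSolution c G Λ P a ρ J := fun t ht => h t (hJ ht)

theorem IsFriedmannSolution.hasDerivAt_friedmannField {I : Set ℝ}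
    (h : IsFriedmannSolution c G Λ P a ρ I) {t : ℝ} (ht : t ∈ I) :
    HasDerivAt (fun t => (a t, deriv a t, ρ t))
      (friedmannField c G Λ P (a t, deriv a t, ρ t)) t :=
  have ⟨_, _, h₁, h₂, h₃⟩ := h t ht
  h₁.hasDerivAt.prodMk (h₂.prodMk h₃)

theorem isFriedmannSolution_of_hasDerivAt_friedmannField {I : Set ℝ} (hI : IsOpen I)
    {y : ℝ → ℝ × ℝ × ℝ} (hy : ∀ t ∈ I, HasDerivAt y (friedmannField c G Λ P (y t)) t)
    (hpos : ∀ t ∈ I, 0 < (y t).1 ∧ 0 < (y t).2.2) :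
    IsFriedmannSolution c G Λ P (fun t => (y t).1) (fun t => (y t).2.2) I := by
  have hfst (t : ℝ) (ht : t ∈ I) : HasDerivAt (fun t => (y t).1) (y t).2.1 t :=
    (hasFDerivAt_fst (𝕜 := ℝ) (p := y t)).comp_hasDerivAt t (hy t ht)
  have hsnd (t : ℝ) (ht : t ∈ I) :=
    (hasFDerivAt_snd (𝕜 := ℝ) (p := y t)).comp_hasDerivAt t (hy t ht)
  intro t ht
  refine ⟨(hpos t ht).1, (hpos t ht).2, (hfst t ht).differentiableAt, ?_, ?_⟩
  · have h₁ : HasDerivAt (fun t => (y t).2.1) _ t :=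
      (hasFDerivAt_fst (𝕜 := ℝ) (p := (y t).2)).comp_hasDerivAt t (hsnd t ht)
    refine h₁.congr_of_eventuallyEq ?_
    filter_upwards [hI.mem_nhds ht] with w hw using (hfst w hw).deriv
  · simp only [(hfst t ht).deriv]
    exact (hasFDerivAt_snd (𝕜 := ℝ) (p := (y t).2)).comp_hasDerivAt t (hsnd t ht)

/-- A maximal solution cannot stay in a compact part of the phase space up to a finite final
time. -/
theorem IsMaximalSolution.not_forall_mem_Icc (hA0 : A0 c P) {tm : EReal} {T τ : ℝ}
    (hmax : IsMaximalSolution c G Λ P a ρ tm T) (hτ : 0 ≤ τ) (hτT : τ < T)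
    {a₁ a₂ v₁ v₂ ρ₁ ρ₂ : ℝ} (ha₁ : 0 < a₁) (hρ₁ : 0 < ρ₁) :
    ¬ ∀ t ∈ Ico τ T, a t ∈ Icc a₁ a₂ ∧ deriv a t ∈ Icc v₁ v₂ ∧ ρ t ∈ Icc ρ₁ ρ₂ := by
  intro hbd
  obtain ⟨htm, -, hsol, hext⟩ := hmax
  obtain ⟨s, hs, hs₀⟩ := EReal.lt_iff_exists_real_btwn.1 htm
  have hs₀ : s < 0 := by exact_mod_cast hs₀
  have hsol' : IsFriedmannSolution c G Λ P a ρ (Ioo s T) := hsol.mono fun t ht =>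
    ⟨hs.trans (by exact_mod_cast ht.1), by exact_mod_cast ht.2⟩
  obtain ⟨u, hu, y, hy, hyx⟩ := exists_extension_of_mem_isCompact
    (v := friedmannField c G Λ P) (U := {x | 0 < x.1 ∧ 0 < x.2.2})
    (K := Icc a₁ a₂ ×ˢ Icc v₁ v₂ ×ˢ Icc ρ₁ ρ₂)
    (x := fun t => (a t, deriv a t, ρ t)) (s := s) (τ := (τ + T) / 2) (T := T)
    ((isOpen_lt continuous_const continuous_fst).inter
      (isOpen_lt continuous_const (continuous_snd.comp continuous_snd)))
    (isCompact_Icc.prod (isCompact_Icc.prod isCompact_Icc))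
    (fun x hx => ⟨ha₁.trans_le hx.1.1, hρ₁.trans_le hx.2.2.1⟩)
    (fun x hx => hA0.contDiffAt_friedmannField hx.1 hx.2) (by linarith)
    (fun t ht => ⟨hsol'.hasDerivAt_friedmannField ht, (hsol' t ht).1, (hsol' t ht).2.1⟩)
    (fun t ht => hbd t ⟨by linarith [ht.1], ht.2⟩)
  have hy₀ : y 0 = (a 0, deriv a 0, ρ 0) := hyx 0 (by linarith)
  have hle := (hext (fun t => (y t).1) (fun t => (y t).2.2) s u hs₀ (by linarith)
    (isFriedmannSolution_of_hasDerivAt_friedmannField isOpen_Ioo (fun t ht => (hy t ht).1)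
      fun t ht => (hy t ht).2) (by simp [hy₀]) ?_ (by simp [hy₀])).2
  · exact absurd (EReal.coe_le_coe_iff.1 hle) (not_le.2 hu)
  · refine EventuallyEq.deriv_eq ?_
    filter_upwards [Iic_mem_nhds (show (0 : ℝ) < (τ + T) / 2 by linarith)] with t ht
    simp [hyx t ht]

theorem A0.monotoneOn (hA0 : A0 c P) : MonotoneOn P (Ioi 0) := by
  refine monotoneOn_of_deriv_nonneg (convex_Ioi 0) hA0.1.continuousOn
    ((hA0.1.differentiableOn (by simp)).mono interior_subset) fun x hx => ?_
  exact (hA0.2.2.1 x (by simpa using hx)).1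

theorem A0.le_sq_mul (hA0 : A0 c P) {r : ℝ} (hr : 0 < r) : P r ≤ c ^ 2 * r := by
  have hle : ∀ᶠ x in 𝓝[>] (0 : ℝ), P r ≤ P x + c ^ 2 * (r - x) := by
    filter_upwards [Ioo_mem_nhdsGT hr] with x hx
    have := (convex_Ioi (0 : ℝ)).image_sub_le_mul_sub_of_deriv_le hA0.1.continuousOn
      ((hA0.1.differentiableOn (by simp)).mono interior_subset)
      (fun x hx => (hA0.2.2.1 x (by simpa using hx)).2.le) x hx.1 r hr hx.2.le
    linarith
  have hlim : Tendsto (fun x => P x + c ^ 2 * (r - x)) (𝓝[>] 0) (𝓝 (0 + c ^ 2 * (r - 0))) :=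
    hA0.2.2.2.add ((tendsto_const_nhds.sub (tendsto_id.mono_left nhdsWithin_le_nhds)).const_mul _)
  simpa using ge_of_tendsto hlim hle

theorem le_add_mul_of_hasDerivAt_le {f f' : ℝ → ℝ} {x y C : ℝ} (hxy : x ≤ y)
    (hf : ∀ t ∈ Icc x y, HasDerivAt f (f' t) t) (hC : ∀ t ∈ Ioo x y, f' t ≤ C) :
    f y ≤ f x + C * (y - x) := by
  rcases hxy.eq_or_lt with rfl | h
  · simp
  obtain ⟨z, hz, hz'⟩ := exists_hasDerivAt_eq_slope f f' h
    (fun t ht => (hf t ht).continuousAt.continuousWithinAt) fun t ht => hf t (Ioo_subset_Icc_self ht)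
  have := hC z hz
  rw [hz', div_le_iff₀ (sub_pos.2 h)] at this
  linarith

theorem add_mul_le_of_le_hasDerivAt {f f' : ℝ → ℝ} {x y C : ℝ} (hxy : x ≤ y)
    (hf : ∀ t ∈ Icc x y, HasDerivAt f (f' t) t) (hC : ∀ t ∈ Ioo x y, C ≤ f' t) :
    f x + C * (y - x) ≤ f y := by
  have := le_add_mul_of_hasDerivAt_le (f := -f) (f' := -f') (C := -C) hxy
    (fun t ht => (hf t ht).neg) fun t ht => neg_le_neg (hC t ht)
  simp only [Pi.neg_apply] at this
  linarith

/-- The deceleration rate, relative to the scale factor, of a Friedmann universe of density `r`. -/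
noncomputable def friedmannDecel (c G Λ : ℝ) (P : ℝ → ℝ) (r : ℝ) : ℝ :=
  4 * Real.pi * G / 3 * (r + 3 * P r / c ^ 2) - c ^ 2 * Λ / 3

theorem A0.monotoneOn_friedmannDecel (hA0 : A0 c P) (hG : 0 < G) :
    MonotoneOn (friedmannDecel c G Λ P) (Ioi 0) := by
  intro x hx y hy hxy
  have := hA0.monotoneOn hx hy hxy
  unfold friedmannDecel
  gcongr

theorem IsFriedmannSolution.hasDerivAt_deriv {I : Set ℝ}
    (h : IsFriedmannSolution c G Λ P a ρ I) {t : ℝ} (ht : t ∈ I) :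
    HasDerivAt (deriv a) (-(friedmannDecel c G Λ P (ρ t) * a t)) t := by
  convert (h t ht).2.2.2.1 using 1
  unfold friedmannDecel
  ring

/-- The density increases while the universe contracts. -/
theorem IsFriedmannSolution.density_le (hA0 : A0 c P) {x y : ℝ}
    (h : IsFriedmannSolution c G Λ P a ρ (Icc x y)) (hxy : x ≤ y)
    (hv : ∀ t ∈ Ioo x y, deriv a t ≤ 0) : ρ x ≤ ρ y := by
  have := add_mul_le_of_le_hasDerivAt (C := 0) hxy (fun t ht => (h t ht).2.2.2.2) fun t ht => by
    obtain ⟨h₁, h₂, -⟩ := h t (Ioo_subset_Icc_self ht)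
    have h₃ : 0 ≤ ρ t + P (ρ t) / c ^ 2 := by have := hA0.2.1 _ h₂; positivity
    have h₄ : deriv a t / a t ≤ 0 := div_nonpos_of_nonpos_of_nonneg (hv t ht) h₁.le
    nlinarith
  linarith

/-- The density decreases while the universe expands. -/
theorem IsFriedmannSolution.le_density (hA0 : A0 c P) {x y : ℝ}
    (h : IsFriedmannSolution c G Λ P a ρ (Icc x y)) (hxy : x ≤ y)
    (hv : ∀ t ∈ Ioo x y, 0 ≤ deriv a t) : ρ y ≤ ρ x := by
  have := le_add_mul_of_hasDerivAt_le (C := 0) hxy (fun t ht => (h t ht).2.2.2.2) fun t ht => by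
    obtain ⟨h₁, h₂, -⟩ := h t (Ioo_subset_Icc_self ht)
    have h₃ : 0 ≤ ρ t + P (ρ t) / c ^ 2 := by have := hA0.2.1 _ h₂; positivity
    have h₄ : 0 ≤ deriv a t / a t := div_nonneg (hv t ht) h₁.le
    nlinarith
  linarith

theorem IsFriedmannSolution.scale_le {x y C : ℝ}
    (h : IsFriedmannSolution c G Λ P a ρ (Icc x y)) (hxy : x ≤ y)
    (hv : ∀ t ∈ Ioo x y, deriv a t ≤ C) : a y ≤ a x + C * (y - x) :=
  le_add_mul_of_hasDerivAt_le hxy (fun t ht => (h t ht).2.2.1.hasDerivAt) hv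

theorem IsFriedmannSolution.le_scale {x y C : ℝ}
    (h : IsFriedmannSolution c G Λ P a ρ (Icc x y)) (hxy : x ≤ y)
    (hv : ∀ t ∈ Ioo x y, C ≤ deriv a t) : a x + C * (y - x) ≤ a y :=
  add_mul_le_of_le_hasDerivAt hxy (fun t ht => (h t ht).2.2.1.hasDerivAt) hv

/-- The expansion rate decreases while the deceleration rate is nonnegative. -/
theorem IsFriedmannSolution.deriv_scale_le {x y : ℝ}
    (h : IsFriedmannSolution c G Λ P a ρ (Icc x y)) (hxy : x ≤ y)
    (hF : ∀ t ∈ Ioo x y, 0 ≤ friedmannDecel c G Λ P (ρ t)) : deriv a y ≤ deriv a x := by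
  have := le_add_mul_of_hasDerivAt_le (C := 0) hxy (fun t ht => h.hasDerivAt_deriv ht)
    fun t ht => neg_nonpos.2 (mul_nonneg (hF t ht) (h t (Ioo_subset_Icc_self ht)).1.le)
  linarith

/-- While a decelerating universe expands, its expansion rate decreases at least linearly. -/
theorem IsFriedmannSolution.deriv_scale_le_of_nonneg {s δ : ℝ}
    (h : IsFriedmannSolution c G Λ P a ρ (Icc 0 s)) (hs : 0 ≤ s) (hδ : 0 ≤ δ)
    (hF : ∀ t ∈ Ioo 0 s, δ ≤ friedmannDecel c G Λ P (ρ t))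
    (hv : ∀ t ∈ Ioo 0 s, 0 ≤ deriv a t) : deriv a s ≤ deriv a 0 - δ * a 0 * s := by
  have := le_add_mul_of_hasDerivAt_le (C := -(δ * a 0)) hs (fun t ht => h.hasDerivAt_deriv ht)
    fun t ht => by
      have h₁ : a 0 ≤ a t := by
        simpa using (h.mono (Icc_subset_Icc_right ht.2.le)).le_scale (C := 0) ht.1.le
          fun r hr => hv r ⟨hr.1, hr.2.trans ht.2⟩
      have h₂ : 0 < a 0 := (h 0 ⟨le_rfl, hs⟩).1
      have h₃ := hF t ht
      gcongr
      linarith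
  linarith

/-- If the initial expansion rate is small, the density never falls to the threshold `ρ₁`. -/
theorem IsFriedmannSolution.lt_density (hA0 : A0 c P) {s δ ρ₁ ε : ℝ}
    (h : IsFriedmannSolution c G Λ P a ρ (Icc 0 s)) (hs : 0 ≤ s) (hδ : 0 < δ)
    (hF : ∀ r ≥ ρ₁, δ ≤ friedmannDecel c G Λ P r) (hv : deriv a 0 ≤ ε) (hε : 0 ≤ ε)
    (hsmall : 3 * (ρ 0 + P (ρ 0) / c ^ 2) * ε ^ 2 < (ρ 0 - ρ₁) * (δ * a 0 ^ 2)) :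
    ρ₁ < ρ s := by
  by_contra! hle
  have ha₀ : 0 < a 0 := (h 0 ⟨le_rfl, hs⟩).1
  have hρ₀ : 0 < ρ 0 := (h 0 ⟨le_rfl, hs⟩).2.1
  set κ := ρ 0 + P (ρ 0) / c ^ 2 with hκ
  have hκ₀ : 0 < κ := by have := hA0.2.1 _ hρ₀; positivity
  have hlt₀ : ρ₁ < ρ 0 := by
    by_contra! hcon
    have : 0 ≤ 3 * κ * ε ^ 2 := by positivity
    have : (ρ 0 - ρ₁) * (δ * a 0 ^ 2) ≤ 0 :=
      mul_nonpos_of_nonpos_of_nonneg (by linarith) (by positivity)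
    linarith
  have hcont : ContinuousOn ρ (Icc 0 s) := fun t ht =>
    (h t ht).2.2.2.2.continuousAt.continuousWithinAt
  obtain ⟨q, ⟨hq, hqρ⟩, hmin⟩ :=
    (isCompact_Icc.of_isClosed_subset (hcont.preimage_isClosed_of_isClosed isClosed_Icc
      (isClosed_Iic (a := ρ₁))) inter_subset_left).exists_isLeast ⟨s, ⟨hs, le_rfl⟩, hle⟩
  have hqρ : ρ q ≤ ρ₁ := hqρ
  have hq₀ : 0 < q := hq.1.lt_of_ne fun h₀ => by rw [← h₀] at hqρ; linarith
  have hgt (t : ℝ) (ht : t ∈ Ico 0 q) : ρ₁ < ρ t := by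
    by_contra! hcon
    exact absurd (hmin ⟨⟨ht.1, ht.2.le.trans hq.2⟩, hcon⟩) (not_le.2 ht.2)
  have hsub {x y : ℝ} (hx : 0 ≤ x) (hy : y ≤ q) :
      IsFriedmannSolution c G Λ P a ρ (Icc x y) :=
    h.mono (Icc_subset_Icc hx (hy.trans hq.2))
  have hanti (x y : ℝ) (hx : 0 ≤ x) (hxy : x ≤ y) (hy : y ≤ q) : deriv a y ≤ deriv a x :=
    (hsub hx hy).deriv_scale_le hxy fun t ht =>
      hδ.le.trans (hF _ (hgt t ⟨hx.trans ht.1.le, ht.2.trans_le hy⟩).le)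
  rcases le_or_gt 0 (deriv a q) with hpos | hneg
  · have hnn (t : ℝ) (ht : t ∈ Icc 0 q) : 0 ≤ deriv a t :=
      hpos.trans (hanti t q ht.1 ht.2 le_rfl)
    have hvq := (hsub le_rfl le_rfl).deriv_scale_le_of_nonneg hq₀.le hδ.le
      (fun t ht => hF _ (hgt t ⟨ht.1.le, ht.2⟩).le) fun t ht => hnn t (Ioo_subset_Icc_self ht)
    have hρq := add_mul_le_of_le_hasDerivAt (C := -3 * κ * (ε / a 0)) hq₀.le
      (fun t ht => (hsub le_rfl le_rfl t ht).2.2.2.2) fun t ht => by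
        have ht' := Ioo_subset_Icc_self ht
        obtain ⟨h₁, h₂, -⟩ := hsub le_rfl le_rfl t ht'
        have ha : a 0 ≤ a t := by
          simpa using (hsub le_rfl ht.2.le).le_scale (C := 0) ht.1.le
            fun r hr => hnn r ⟨hr.1.le, (hr.2.trans ht.2).le⟩
        have hρ : ρ t ≤ ρ 0 := (hsub le_rfl ht.2.le).le_density hA0 ht.1.le
            fun r hr => hnn r ⟨hr.1.le, (hr.2.trans ht.2).le⟩
        have hP : P (ρ t) ≤ P (ρ 0) := hA0.monotoneOn h₂ hρ₀ hρ
        have h₃ : ρ t + P (ρ t) / c ^ 2 ≤ κ := by rw [hκ]; gcongr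
        have h₄ : deriv a t / a t ≤ ε / a 0 := by
          have := (hanti 0 t le_rfl ht.1.le ht.2.le).trans hv
          gcongr
        have h₅ : 0 ≤ deriv a t / a t := div_nonneg (hnn t ht') h₁.le
        have := mul_le_mul h₃ h₄ h₅ hκ₀.le
        linarith
    have hqε : q ≤ ε / (δ * a 0) := by
      rw [le_div_iff₀ (by positivity)]
      linarith
    have h₁ : 3 * κ * (ε / a 0) * q ≤ 3 * κ * (ε / a 0) * (ε / (δ * a 0)) := by gcongr
    have h₂ : 3 * κ * (ε / a 0) * (ε / (δ * a 0)) = 3 * κ * ε ^ 2 / (δ * a 0 ^ 2) := by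
      field_simp
    have h₃ : 3 * κ * ε ^ 2 / (δ * a 0 ^ 2) < ρ 0 - ρ₁ := by rwa [div_lt_iff₀ (by positivity)]
    linarith
  · have hev : ∀ᶠ t in 𝓝[<] q, deriv a t < 0 :=
      ((h.hasDerivAt_deriv hq).continuousAt.eventually_lt continuousAt_const hneg).filter_mono
        nhdsWithin_le_nhds
    obtain ⟨r, hr, hr'⟩ := (hev.and (Ioo_mem_nhdsLT hq₀)).exists
    have := (hsub hr'.1.le le_rfl).density_le hA0 hr'.2.le fun t ht =>
      (hanti r t hr'.1.le ht.1.le ht.2.le).trans hr.le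
    linarith [hgt r ⟨hr'.1.le, hr'.2⟩]

theorem exists_eq_coe_of_forall_le {tp : EReal} (h₀ : 0 < tp) {B : ℝ}
    (h : ∀ t : ℝ, 0 ≤ t → (t : EReal) < tp → t ≤ B) : ∃ T : ℝ, tp = T ∧ 0 < T := by
  have hle : tp ≤ (B : EReal) := by
    by_contra! hlt
    obtain ⟨r, hr, hr'⟩ := EReal.lt_iff_exists_real_btwn.1 (max_lt hlt h₀)
    rw [max_lt_iff] at hr
    exact absurd (h r (by exact_mod_cast hr.2.le) hr') (not_le.2 (by exact_mod_cast hr.1))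
  lift tp to ℝ using ⟨ne_top_of_le_ne_top (EReal.coe_ne_top B) hle, (bot_lt_of_lt h₀).ne'⟩
  exact ⟨tp, rfl, by exact_mod_cast h₀⟩

/-- A contracting, decelerating maximal solution with finite final time ends in a Big Crunch. -/
theorem IsMaximalSolution.tendsto_of_deriv_neg (hA0 : A0 c P) (hc : 0 < c) (hG : 0 < G)
    {tm : EReal} {T τ : ℝ} (hmax : IsMaximalSolution c G Λ P a ρ tm T) (hτ : 0 ≤ τ) (hτT : τ < T)
    (hF : ∀ t ∈ Ico τ T, 0 ≤ friedmannDecel c G Λ P (ρ t)) (hv : deriv a τ < 0) :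
    Tendsto a (𝓝[<] T) (𝓝 0) ∧ Tendsto ρ (𝓝[<] T) atTop := by
  have hsub {x y : ℝ} (hx : τ ≤ x) (hy : y < T) : IsFriedmannSolution c G Λ P a ρ (Icc x y) :=
    hmax.2.2.1.mono fun t ht =>
      ⟨hmax.1.trans_le (by exact_mod_cast hτ.trans (hx.trans ht.1)),
        by exact_mod_cast ht.2.trans_lt hy⟩
  have hsol (t : ℝ) (ht : t ∈ Ico τ T) := hsub ht.1 ht.2 t ⟨le_rfl, le_rfl⟩
  have hvt (t : ℝ) (ht : t ∈ Ico τ T) : deriv a t ≤ deriv a τ :=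
    (hsub le_rfl ht.2).deriv_scale_le ht.1 fun r hr => hF r ⟨hr.1.le, hr.2.trans ht.2⟩
  have hanti (x y : ℝ) (hx : τ ≤ x) (hxy : x ≤ y) (hy : y < T) : a y ≤ a x := by
    simpa using (hsub hx hy).scale_le (C := 0) hxy
      fun r hr => (hvt r ⟨hx.trans hr.1.le, hr.2.trans hy⟩).trans hv.le
  have hρτ (t : ℝ) (ht : t ∈ Ico τ T) : ρ τ ≤ ρ t :=
    (hsub le_rfl ht.2).density_le hA0 ht.1
      fun r hr => (hvt r ⟨hr.1.le, hr.2.trans ht.2⟩).trans hv.le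
  obtain ⟨haτ, hρτ₀, -⟩ := hsol τ ⟨le_rfl, hτT⟩
  have hcube (t : ℝ) (ht : t ∈ Ico τ T) : ρ τ * a τ ^ 3 ≤ ρ t * a t ^ 3 := by
    have := add_mul_le_of_le_hasDerivAt (C := 0) ht.1 (fun r hr =>
      have h := hsub le_rfl ht.2 r hr
      h.2.2.2.2.mul (h.2.2.1.hasDerivAt.pow 3)) fun r hr => by
        have hr' : r ∈ Ico τ T := ⟨hr.1.le, hr.2.trans ht.2⟩
        obtain ⟨h₁, h₂, -⟩ := hsol r hr'
        have h₃ := (hvt r hr').trans hv.le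
        have h₄ : 0 ≤ P (ρ r) / c ^ 2 := by have := hA0.2.1 _ h₂; positivity
        have h₅ : 0 ≤ 3 * (P (ρ r) / c ^ 2) * a r ^ 2 * (-deriv a r) :=
          mul_nonneg (by positivity) (by linarith)
        refine h₅.trans_eq ?_
        field_simp
        simp only [Pi.pow_apply]
        field_simp
        ring
    simpa using this
  have hsixth (t : ℝ) (ht : t ∈ Ico τ T) : ρ t * a t ^ 6 ≤ ρ τ * a τ ^ 6 := by
    have := le_add_mul_of_hasDerivAt_le (C := 0) ht.1 (fun r hr =>
      have h := hsub le_rfl ht.2 r hr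
      h.2.2.2.2.mul (h.2.2.1.hasDerivAt.pow 6)) fun r hr => by
        have hr' : r ∈ Ico τ T := ⟨hr.1.le, hr.2.trans ht.2⟩
        obtain ⟨h₁, h₂, -⟩ := hsol r hr'
        have h₃ := (hvt r hr').trans hv.le
        have h₄ : P (ρ r) / c ^ 2 ≤ ρ r := by
          rw [div_le_iff₀ (by positivity), mul_comm]
          exact hA0.le_sq_mul h₂
        have h₅ : 3 * (ρ r - P (ρ r) / c ^ 2) * a r ^ 5 * deriv a r ≤ 0 :=
          mul_nonpos_of_nonneg_of_nonpos (mul_nonneg (by linarith) (by positivity)) h₃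
        refine Eq.trans_le ?_ h₅
        simp only [Pi.pow_apply]
        field_simp
        ring
    simpa using this
  have hsmall (α : ℝ) (hα : 0 < α) : ∃ t ∈ Ico τ T, a t < α := by
    by_contra! hge
    set R := ρ τ * a τ ^ 6 / α ^ 6
    have hρR (t : ℝ) (ht : t ∈ Ico τ T) : ρ t ≤ R := by
      rw [le_div_iff₀ (by positivity)]
      refine le_trans ?_ (hsixth t ht)
      have := hge t ht
      have := (hsol t ht).2.1
      gcongr
    have hR : 0 < R := by positivity
    have hFR : 0 ≤ friedmannDecel c G Λ P R * a τ := by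
      refine mul_nonneg ((hF τ ⟨le_rfl, hτT⟩).trans ?_) haτ.le
      exact hA0.monotoneOn_friedmannDecel hG hρτ₀ hR (hρR τ ⟨le_rfl, hτT⟩)
    refine hmax.not_forall_mem_Icc hA0 hτ hτT (a₂ := a τ) (v₂ := 0)
      (v₁ := deriv a τ - friedmannDecel c G Λ P R * a τ * (T - τ)) hα hρτ₀ fun t ht =>
      ⟨⟨hge t ht, hanti τ t le_rfl ht.1 ht.2⟩, ⟨?_, (hvt t ht).trans hv.le⟩,
        ⟨hρτ t ht, hρR t ht⟩⟩
    have := add_mul_le_of_le_hasDerivAt (C := -(friedmannDecel c G Λ P R * a τ)) ht.1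
      (fun r hr => (hsub le_rfl ht.2).hasDerivAt_deriv hr) fun r hr => by
        have hr' : r ∈ Ico τ T := ⟨hr.1.le, hr.2.trans ht.2⟩
        have h₁ := hA0.monotoneOn_friedmannDecel (Λ := Λ) hG (hsol r hr').2.1 hR (hρR r hr')
        exact neg_le_neg (mul_le_mul h₁ (hanti τ r le_rfl hr'.1 hr'.2) (hsol r hr').1.le
          ((hF r hr').trans h₁))
    have : friedmannDecel c G Λ P R * a τ * (t - τ) ≤ friedmannDecel c G Λ P R * a τ * (T - τ) :=
      mul_le_mul_of_nonneg_left (by linarith [ht.2]) hFR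
    linarith
  have hpos : ∀ᶠ t in 𝓝[<] T, t ∈ Ico τ T :=
    mem_of_superset (Ioo_mem_nhdsLT hτT) Ioo_subset_Ico_self
  have ha : Tendsto a (𝓝[<] T) (𝓝 0) := by
    refine tendsto_order.2 ⟨fun b hb => ?_, fun b hb => ?_⟩
    · filter_upwards [hpos] with t ht using hb.trans (hsol t ht).1
    · obtain ⟨t, ht, htb⟩ := hsmall b hb
      filter_upwards [Ioo_mem_nhdsLT ht.2] with r hr
      exact (hanti t r ht.1 hr.1.le hr.2).trans_lt htb
  refine ⟨ha, ?_⟩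
  have ha₃ : Tendsto (fun t => a t ^ 3) (𝓝[<] T) (𝓝[>] 0) := by
    refine tendsto_nhdsWithin_iff.2 ⟨by simpa using ha.pow 3, ?_⟩
    filter_upwards [hpos] with t ht using pow_pos (hsol t ht).1 3
  refine tendsto_atTop_mono' _ ?_ (ha₃.inv_tendsto_nhdsGT_zero.const_mul_atTop
    (show 0 < ρ τ * a τ ^ 3 by positivity))
  filter_upwards [hpos] with t ht
  have := (hsol t ht).1
  rw [Pi.inv_apply, ← div_eq_mul_inv, div_le_iff₀ (by positivity)]
  exact hcube t ht

theorem A0.exists_lt_friedmannDecel_pos (hA0 : A0 c P) {ρ₀ : ℝ} (hρ₀ : 0 < ρ₀)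
    (h : 0 < friedmannDecel c G Λ P ρ₀) :
    ∃ ρ₁ ∈ Ioo 0 ρ₀, 0 < friedmannDecel c G Λ P ρ₁ := by
  have hP : ContinuousAt P ρ₀ := hA0.1.continuousOn.continuousAt (Ioi_mem_nhds hρ₀)
  have hF : ContinuousAt (friedmannDecel c G Λ P) ρ₀ := by
    unfold friedmannDecel
    fun_prop
  obtain ⟨r, hr, hr'⟩ := (((hF.eventually_const_lt h).filter_mono nhdsWithin_le_nhds).and
    (Ioo_mem_nhdsLT hρ₀)).exists
  exact ⟨r, hr', hr⟩

end

/-- Corollary 3: if `4πG(ρ₀ + 3P(ρ₀)/c²) > c²Λ`, then for all sufficiently small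
`ȧ₀ > 0` the solution ends in a Big Crunch: `t₊ < +∞` and `a(t) → 0`,
`ρ(t) → +∞` as `t → t₊ - 0`. -/
theorem big_crunch_of_small_initial_expansion
    (c G Λ : ℝ) (hc : 0 < c) (hG : 0 < G) (hΛ : 0 < Λ)
    (P : ℝ → ℝ) (hA0 : A0 c P)
    (a0 ρ0 : ℝ) (ha0pos : 0 < a0) (hρ0pos : 0 < ρ0)
    (hcond : c ^ 2 * Λ < 4 * Real.pi * G * (ρ0 + 3 * P ρ0 / c ^ 2)) :
    ∃ ε : ℝ, 0 < ε ∧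
      ∀ adot0 : ℝ, 0 < adot0 → adot0 ≤ ε →
        ∀ (a ρ : ℝ → ℝ) (tm tp : EReal),
          IsMaximalSolution c G Λ P a ρ tm tp →
          a 0 = a0 → deriv a 0 = adot0 → ρ 0 = ρ0 →
          ∃ T : ℝ, tp = (T : EReal) ∧
            Filter.Tendsto a (nhdsWithin T (Set.Iio T)) (nhds 0) ∧
            Filter.Tendsto ρ (nhdsWithin T (Set.Iio T)) Filter.atTop := by
  have hF₀ : 0 < friedmannDecel c G Λ P ρ0 := by
    unfold friedmannDecel
    linarith
  obtain ⟨ρ₁, hρ₁, hδ⟩ := hA0.exists_lt_friedmannDecel_pos hρ0pos hF₀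
  set δ := friedmannDecel c G Λ P ρ₁ with hδ_def
  have hF : ∀ r ≥ ρ₁, δ ≤ friedmannDecel c G Λ P r := fun r hr =>
    hA0.monotoneOn_friedmannDecel hG hρ₁.1 (hρ₁.1.trans_le hr) hr
  obtain ⟨ε, hε, hsmall⟩ : ∃ ε > 0,
      3 * (ρ0 + P ρ0 / c ^ 2) * ε ^ 2 < (ρ0 - ρ₁) * (δ * a0 ^ 2) := by
    have hcont : Continuous fun ε : ℝ => 3 * (ρ0 + P ρ0 / c ^ 2) * ε ^ 2 := by fun_prop
    have h₀ : 3 * (ρ0 + P ρ0 / c ^ 2) * (0 : ℝ) ^ 2 < (ρ0 - ρ₁) * (δ * a0 ^ 2) := by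
      have := sub_pos.2 hρ₁.2
      simp only [ne_eq, OfNat.ofNat_ne_zero, not_false_eq_true, zero_pow, mul_zero]
      positivity
    obtain ⟨ε, hε, hε'⟩ := (((hcont.continuousAt.eventually_lt continuousAt_const
      h₀).filter_mono nhdsWithin_le_nhds).and (self_mem_nhdsWithin (s := Ioi (0 : ℝ)))).exists
    exact ⟨ε, hε', hε⟩
  refine ⟨ε, hε, fun adot0 hadot hadotε a ρ tm tp hmax ha₀ hv₀ hρ₀ => ?_⟩
  subst ha₀ hρ₀
  have hsub {x y : ℝ} (hx : 0 ≤ x) (hy : (y : EReal) < tp) :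
      IsFriedmannSolution c G Λ P a ρ (Icc x y) :=
    hmax.2.2.1.mono fun t ht => ⟨hmax.1.trans_le (by exact_mod_cast hx.trans ht.1),
      lt_of_le_of_lt (by exact_mod_cast ht.2) hy⟩
  have hgt (t : ℝ) (ht : 0 ≤ t) (ht' : (t : EReal) < tp) : ρ₁ < ρ t :=
    (hsub le_rfl ht').lt_density hA0 ht hδ hF (hv₀.trans_le hadotε) hε.le hsmall
  have hFt (t : ℝ) (ht : 0 ≤ t) (ht' : (t : EReal) < tp) : δ ≤ friedmannDecel c G Λ P (ρ t) :=
    hF _ (hgt t ht ht').le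
  have hlt {x y : ℝ} (hxy : x ≤ y) (hy : (y : EReal) < tp) : (x : EReal) < tp :=
    lt_of_le_of_lt (by exact_mod_cast hxy) hy
  have hanti (x y : ℝ) (hx : 0 ≤ x) (hxy : x ≤ y) (hy : (y : EReal) < tp) :
      deriv a y ≤ deriv a x :=
    (hsub hx hy).deriv_scale_le hxy fun t ht =>
      hδ.le.trans (hFt t (hx.trans ht.1.le) (hlt ht.2.le hy))
  by_cases hneg : ∃ τ : ℝ, 0 ≤ τ ∧ (τ : EReal) < tp ∧ deriv a τ < 0
  · obtain ⟨τ, hτ, hτp, hvτ⟩ := hneg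
    obtain ⟨T, rfl, hT⟩ := exists_eq_coe_of_forall_le hmax.2.1
      (B := τ + a τ / -deriv a τ) fun t ht ht' => by
        have haτ : 0 < a τ := (hsub hτ hτp τ ⟨le_rfl, le_rfl⟩).1
        have hvτ' : 0 < -deriv a τ := by linarith
        rcases le_total t τ with h | h
        · have : 0 < a τ / -deriv a τ := by positivity
          linarith
        · have h₁ := (hsub hτ ht').scale_le h fun r hr => hanti τ r hτ hr.1.le (hlt hr.2.le ht')
          have h₂ := (hsub ht ht' t ⟨le_rfl, le_rfl⟩).1
          have : t - τ ≤ a τ / -deriv a τ := by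
            rw [le_div_iff₀ hvτ']
            linarith
          linarith
    exact ⟨T, rfl, hmax.tendsto_of_deriv_neg hA0 hc hG hτ (by exact_mod_cast hτp)
      (fun t ht => hδ.le.trans (hFt t (hτ.trans ht.1) (by exact_mod_cast ht.2))) hvτ⟩
  · exfalso
    push Not at hneg
    obtain ⟨T, rfl, hT⟩ := exists_eq_coe_of_forall_le hmax.2.1
      (B := deriv a 0 / (δ * a 0)) fun t ht ht' => by
        have := (hsub le_rfl ht').deriv_scale_le_of_nonneg ht hδ.le
          (fun r hr => hFt r hr.1.le (hlt hr.2.le ht'))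
          fun r hr => hneg r hr.1.le (hlt hr.2.le ht')
        rw [le_div_iff₀ (by positivity)]
        linarith [hneg t ht ht']
    refine hmax.not_forall_mem_Icc hA0 le_rfl hT (a₁ := a 0) (a₂ := a 0 + deriv a 0 * T)
      (v₁ := 0) (v₂ := deriv a 0) (ρ₂ := ρ 0) ha0pos hρ₁.1 fun t ht => ?_
    have ht' : (t : EReal) < T := by exact_mod_cast ht.2
    have hnn (r : ℝ) (hr : r ∈ Ioo 0 t) : 0 ≤ deriv a r := hneg r hr.1.le (hlt hr.2.le ht')
    have h₁ := (hsub le_rfl ht').le_scale ht.1 hnn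
    have h₂ := (hsub le_rfl ht').scale_le ht.1 fun r hr =>
      hanti 0 r le_rfl hr.1.le (hlt hr.2.le ht')
    have h₃ : deriv a 0 * (t - 0) ≤ deriv a 0 * T :=
      mul_le_mul_of_nonneg_left (by linarith [ht.2]) (by linarith)
    exact ⟨⟨by linarith, by linarith⟩, ⟨hneg t ht.1 ht', hanti 0 t le_rfl ht.1 ht'⟩,
      (hgt t ht.1 ht').le, (hsub le_rfl ht').le_density hA0 ht.1 hnn⟩
end

section
/- (Time-reversed Theorem 1: Big Crunch.) Assume (A0). Let $(a,\rho)$ be the solution of the Friedmann system with initial data $a(0)=a_0>0$, $a'(0)=\dot a_0$, $\rho(0)=\rho_0>0$, on its maximal interval of existence $]t_-,t_+[$ in $\{a>0,\ \rho>0\}$. If $\dot a_0<0$ and $4\pi G(\rho_0+3P(\rho_0)/c^2)\ge c^2\Lambda$, then $t_+$ is finite, and $a(t)\to 0$ and $\rho(t)\to+\infty$ as $t\to t_+-0$. -/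
open Real Filter Set Topology

theorem monotoneOn_Icc_of_hasDerivAt_nonneg {f f' : ℝ → ℝ} {x y : ℝ}
    (hf : ∀ t ∈ Icc x y, HasDerivAt f (f' t) t) (hf' : ∀ t ∈ Ioo x y, 0 ≤ f' t) :
    MonotoneOn f (Icc x y) := by
  refine monotoneOn_of_hasDerivWithinAt_nonneg (f' := f') (convex_Icc x y)
    (fun t ht => (hf t ht).continuousAt.continuousWithinAt) (fun t ht => ?_) (fun t ht => ?_)
  · exact (hf t (interior_subset ht)).hasDerivWithinAt
  · rw [interior_Icc] at ht
    exact hf' t ht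

theorem antitoneOn_Icc_of_hasDerivAt_nonpos {f f' : ℝ → ℝ} {x y : ℝ}
    (hf : ∀ t ∈ Icc x y, HasDerivAt f (f' t) t) (hf' : ∀ t ∈ Ioo x y, f' t ≤ 0) :
    AntitoneOn f (Icc x y) := by
  have h := monotoneOn_Icc_of_hasDerivAt_nonneg (f := fun t => -f t) (f' := fun t => -f' t)
    (fun t ht => (hf t ht).neg) (fun t ht => neg_nonneg.2 (hf' t ht))
  exact fun s hs t ht hst => neg_le_neg_iff.1 (h hs ht hst)

/-- A solution of an autonomous differential equation which converges, as `t → T⁻`, to a point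
where the vector field is `C¹` can be continued past `T`. -/
theorem exists_hasDerivAt_extension {E : Type*} [NormedAddCommGroup E] [NormedSpace ℝ E]
    [CompleteSpace E] {f : E → E} {y : ℝ → E} {s T : ℝ} {y₀ : E} {U : Set E} (hsT : s < T)
    (hy : ∀ t ∈ Ioo s T, HasDerivAt y (f (y t)) t) (hlim : Tendsto y (𝓝[<] T) (𝓝 y₀))
    (hf : ContDiffAt ℝ 1 f y₀) (hU : U ∈ 𝓝 y₀) :
    ∃ (w : ℝ → E) (u : ℝ), T < u ∧ (∀ t < T, w t = y t) ∧ (∀ t ∈ Ico T u, w t ∈ U) ∧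
      ∀ t ∈ Ioo s u, HasDerivAt w (f (w t)) t := by
  obtain ⟨z, hzT, ε, hε, hz⟩ :=
    hf.exists_forall_mem_closedBall_exists_eq_forall_mem_Ioo_hasDerivAt₀ T
  have hzT' := hz T ⟨by linarith, by linarith⟩
  have hzU : ∀ᶠ t in 𝓝 T, z t ∈ U := hzT'.continuousAt (by rwa [hzT])
  obtain ⟨δ, hδ, hzδ⟩ := Metric.eventually_nhds_iff.1 hzU
  classical
  let w : ℝ → E := fun t => if t < T then y t else z t
  have hw_lt : ∀ t < T, w t = y t := fun t ht => if_pos ht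
  have hw_ge : ∀ t, T ≤ t → w t = z t := fun t ht => if_neg ht.not_gt
  have hwT : w T = y₀ := (hw_ge T le_rfl).trans hzT
  have hw_left : ∀ t ∈ Ioo s T, HasDerivAt w (f (w t)) t := fun t ht => by
    rw [hw_lt t ht.2]
    refine (hy t ht).congr_of_eventuallyEq ?_
    filter_upwards [Iio_mem_nhds ht.2] with x hx using hw_lt x hx
  have hw_lim : Tendsto w (𝓝[<] T) (𝓝 y₀) := by
    refine hlim.congr' ?_
    filter_upwards [self_mem_nhdsWithin] with x hx using (hw_lt x hx).symm
  refine ⟨w, T + min ε δ, by have := lt_min hε hδ; linarith, hw_lt, fun t ht => ?_,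
    fun t ht => ?_⟩
  · rw [hw_ge t ht.1]
    apply hzδ
    rw [Real.dist_eq, abs_of_nonneg (by linarith [ht.1])]
    linarith [ht.2, min_le_right ε δ]
  · have htε : t < T + ε := by linarith [ht.2, min_le_left ε δ]
    rcases lt_trichotomy t T with h | rfl | h
    · exact hw_left t ⟨ht.1, h⟩
    · rw [hwT]
      have hL : HasDerivWithinAt w (f y₀) (Iic t) t := by
        refine hasDerivWithinAt_Iic_of_tendsto_deriv (s := Ioo s t)
          (fun x hx => (hw_left x hx).differentiableAt.differentiableWithinAt) ?_
          (Ioo_mem_nhdsLT hsT) ?_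
        · rw [ContinuousWithinAt, hwT]
          exact hw_lim.mono_left (nhdsWithin_mono _ Ioo_subset_Iio_self)
        · refine (hf.continuousAt.tendsto.comp hw_lim).congr' ?_
          filter_upwards [Ioo_mem_nhdsLT hsT] with x hx using (hw_left x hx).deriv.symm
      have hR : HasDerivWithinAt w (f y₀) (Ici t) t := by
        rw [hzT] at hzT'
        exact hzT'.hasDerivWithinAt.congr (fun x hx => hw_ge x hx) (hw_ge t le_rfl)
      have h := hL.union hR
      rwa [Iic_union_Ici, hasDerivWithinAt_univ] at h
    · rw [hw_ge t h.le]
      refine (hz t ⟨by linarith, htε⟩).congr_of_eventuallyEq ?_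
      filter_upwards [Ioi_mem_nhds h] with x hx using hw_ge x (le_of_lt hx)

namespace A0

variable {c : ℝ} {P : ℝ → ℝ}

theorem differentiableAt (h : A0 c P) {r : ℝ} (hr : 0 < r) : DifferentiableAt ℝ P r :=
  (h.1.contDiffAt (Ioi_mem_nhds hr)).differentiableAt (by simp)

theorem monotoneOn_s14 (h : A0 c P) : MonotoneOn P (Ioi 0) := by
  refine monotoneOn_of_deriv_nonneg (convex_Ioi 0) h.1.continuousOn ?_ fun r hr => ?_
  · exact fun r hr => (h.differentiableAt (interior_subset hr)).differentiableWithinAt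
  · exact (h.2.2.1 r (interior_subset hr)).1

theorem le_sq_mul_s14 (h : A0 c P) {r : ℝ} (hr : 0 < r) : P r ≤ c ^ 2 * r := by
  have hanti : AntitoneOn (fun x => P x - c ^ 2 * x) (Ioi 0) := by
    have hd : ∀ x ∈ Ioi (0 : ℝ),
        HasDerivAt (fun x => P x - c ^ 2 * x) (deriv P x - c ^ 2 * 1) x := fun x hx =>
      (h.differentiableAt hx).hasDerivAt.sub ((hasDerivAt_id x).const_mul _)
    refine antitoneOn_of_deriv_nonpos (convex_Ioi 0)
      (fun x hx => (hd x hx).continuousAt.continuousWithinAt)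
      (fun x hx => (hd x (interior_subset hx)).differentiableAt.differentiableWithinAt)
      fun x hx => ?_
    rw [(hd x (interior_subset hx)).deriv]
    linarith [(h.2.2.1 x (interior_subset hx)).2]
  have hlim : Tendsto (fun x => P x - c ^ 2 * x) (𝓝[>] 0) (𝓝 (0 - c ^ 2 * 0)) :=
    h.2.2.2.sub ((continuous_const.mul continuous_id).tendsto' _ _ rfl |>.mono_left
      nhdsWithin_le_nhds)
  have := ge_of_tendsto hlim (b := P r - c ^ 2 * r) (by
    filter_upwards [Ioo_mem_nhdsGT hr] with x hx using hanti hx.1 hr hx.2.le)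
  linarith

end A0

namespace IsFriedmannSolution

variable {c G Λ : ℝ} {P a ρ : ℝ → ℝ} {τ : ℝ}

theorem mono_s14 {I J : Set ℝ} (h : IsFriedmannSolution c G Λ P a ρ I) (hJ : J ⊆ I) :
    IsFriedmannSolution c G Λ P a ρ J := fun t ht => h t (hJ ht)

theorem monotoneOn_density (h : IsFriedmannSolution c G Λ P a ρ (Icc 0 τ)) (hP : A0 c P)
    (hneg : ∀ t ∈ Ioo 0 τ, deriv a t < 0) : MonotoneOn ρ (Icc 0 τ) := by
  refine monotoneOn_Icc_of_hasDerivAt_nonneg (fun t ht => (h t ht).2.2.2.2) fun t ht => ?_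
  obtain ⟨ha, hρ, -⟩ := h t (Ioo_subset_Icc_self ht)
  have h1 : 0 ≤ P (ρ t) / c ^ 2 := div_nonneg (hP.2.1 _ hρ) (sq_nonneg c)
  have h2 := div_neg_of_neg_of_pos (hneg t ht) ha
  nlinarith

theorem antitoneOn_deriv (h : IsFriedmannSolution c G Λ P a ρ (Icc 0 τ)) (hG : 0 < G)
    (hP : A0 c P) (hcond : c ^ 2 * Λ ≤ 4 * π * G * (ρ 0 + 3 * P (ρ 0) / c ^ 2))
    (hneg : ∀ t ∈ Ioo 0 τ, deriv a t < 0) : AntitoneOn (deriv a) (Icc 0 τ) := by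
  refine antitoneOn_Icc_of_hasDerivAt_nonpos (fun t ht => (h t ht).2.2.2.1) fun t ht => ?_
  have ht' := Ioo_subset_Icc_self ht
  have h0 : (0 : ℝ) ∈ Icc 0 τ := ⟨le_rfl, ht.1.le.trans ht.2.le⟩
  have hρ := h.monotoneOn_density hP hneg h0 ht' ht.1.le
  have hPρ := hP.monotoneOn_s14 (h 0 h0).2.1 (h t ht').2.1 hρ
  refine mul_nonpos_of_nonpos_of_nonneg ?_ (h t ht').1.le
  have hW : ρ 0 + 3 * P (ρ 0) / c ^ 2 ≤ ρ t + 3 * P (ρ t) / c ^ 2 := by gcongr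
  have := mul_le_mul_of_nonneg_left hW (show 0 ≤ 4 * π * G by positivity)
  linarith

theorem deriv_neg (h : IsFriedmannSolution c G Λ P a ρ (Icc 0 τ)) (hG : 0 < G)
    (hP : A0 c P) (hcond : c ^ 2 * Λ ≤ 4 * π * G * (ρ 0 + 3 * P (ρ 0) / c ^ 2))
    (h0 : deriv a 0 < 0) : ∀ t ∈ Icc 0 τ, deriv a t < 0 := by
  by_contra! hcon
  have hcont : ContinuousOn (deriv a) (Icc 0 τ) := fun t ht =>
    (h t ht).2.2.2.1.continuousAt.continuousWithinAt
  obtain ⟨t, ⟨ht, ht0⟩, hmin⟩ :=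
    (isCompact_Icc.of_isClosed_subset (hcont.preimage_isClosed_of_isClosed isClosed_Icc
      (isClosed_Ici (a := (0 : ℝ)))) inter_subset_left).exists_isLeast
      (s := Icc 0 τ ∩ deriv a ⁻¹' Ici 0) hcon
  have hsub : Icc 0 t ⊆ Icc 0 τ := Icc_subset_Icc_right ht.2
  have hneg : ∀ x ∈ Ioo 0 t, deriv a x < 0 := fun x hx => by
    by_contra! hx'
    exact hx.2.not_ge (hmin ⟨hsub (Ioo_subset_Icc_self hx), hx'⟩)
  have := (h.mono_s14 hsub).antitoneOn_deriv hG hP hcond hneg (left_mem_Icc.2 ht.1)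
    (right_mem_Icc.2 ht.1) ht.1
  have ht0' : 0 ≤ deriv a t := ht0
  linarith

theorem antitoneOn_scale (h : IsFriedmannSolution c G Λ P a ρ (Icc 0 τ))
    (hneg : ∀ t ∈ Icc 0 τ, deriv a t < 0) : AntitoneOn a (Icc 0 τ) :=
  antitoneOn_Icc_of_hasDerivAt_nonpos (fun t ht => (h t ht).2.2.1.hasDerivAt)
    fun t ht => (hneg t (Ioo_subset_Icc_self ht)).le

theorem scale_le_s14 (h : IsFriedmannSolution c G Λ P a ρ (Icc 0 τ))
    (hle : ∀ t ∈ Icc 0 τ, deriv a t ≤ deriv a 0) (hτ : 0 ≤ τ) :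
    a τ ≤ a 0 + deriv a 0 * τ := by
  have hm : AntitoneOn (fun t => a t - deriv a 0 * t) (Icc 0 τ) :=
    antitoneOn_Icc_of_hasDerivAt_nonpos
      (fun t ht => (h t ht).2.2.1.hasDerivAt.sub ((hasDerivAt_id t).const_mul (deriv a 0)))
      fun t ht => by linarith [hle t (Ioo_subset_Icc_self ht)]
  have := hm (left_mem_Icc.2 hτ) (right_mem_Icc.2 hτ) hτ
  simp only [mul_zero, sub_zero] at this
  linarith

/-- A lower bound for the density in terms of the scale factor, from `P ≥ 0`. -/
theorem density_mul_cube_le (h : IsFriedmannSolution c G Λ P a ρ (Icc 0 τ)) (hP : A0 c P)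
    (hneg : ∀ t ∈ Icc 0 τ, deriv a t < 0) (hτ : 0 ≤ τ) :
    ρ 0 * a 0 ^ 3 ≤ ρ τ * a τ ^ 3 := by
  have hm : MonotoneOn (fun t => ρ t * a t ^ 3) (Icc 0 τ) := by
    refine monotoneOn_Icc_of_hasDerivAt_nonneg
      (fun t ht => (h t ht).2.2.2.2.mul ((h t ht).2.2.1.hasDerivAt.pow 3)) fun t ht => ?_
    have ht' := Ioo_subset_Icc_self ht
    obtain ⟨ha, hρ, -⟩ := h t ht'
    have h1 : 0 ≤ P (ρ t) / c ^ 2 := div_nonneg (hP.2.1 _ hρ) (sq_nonneg c)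
    have h2 : 0 ≤ 3 * (P (ρ t) / c ^ 2) * (a t ^ 2 * -deriv a t) := by
      have := neg_pos.2 (hneg t ht')
      positivity
    convert h2 using 1
    generalize P (ρ t) / c ^ 2 = q
    simp
    field_simp
    ring
  exact hm (left_mem_Icc.2 hτ) (right_mem_Icc.2 hτ) hτ

/-- An upper bound for the density in terms of the scale factor, from `P ≤ c² ρ`. -/
theorem density_mul_pow_six_le (h : IsFriedmannSolution c G Λ P a ρ (Icc 0 τ)) (hc : 0 < c)
    (hP : A0 c P) (hneg : ∀ t ∈ Icc 0 τ, deriv a t < 0) (hτ : 0 ≤ τ) :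
    ρ τ * a τ ^ 6 ≤ ρ 0 * a 0 ^ 6 := by
  have hm : AntitoneOn (fun t => ρ t * a t ^ 6) (Icc 0 τ) := by
    refine antitoneOn_Icc_of_hasDerivAt_nonpos
      (fun t ht => (h t ht).2.2.2.2.mul ((h t ht).2.2.1.hasDerivAt.pow 6)) fun t ht => ?_
    have ht' := Ioo_subset_Icc_self ht
    obtain ⟨ha, hρ, -⟩ := h t ht'
    have h1 : P (ρ t) / c ^ 2 ≤ ρ t := by
      rw [div_le_iff₀ (by positivity)]
      linarith [hP.le_sq_mul_s14 hρ]
    have h2 : 3 * (ρ t - P (ρ t) / c ^ 2) * (a t ^ 5 * deriv a t) ≤ 0 :=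
      mul_nonpos_of_nonneg_of_nonpos (by linarith)
        (mul_nonpos_of_nonneg_of_nonpos (by positivity) (hneg t ht').le)
    convert h2 using 1
    generalize P (ρ t) / c ^ 2 = q
    simp
    field_simp
    ring
  exact hm (left_mem_Icc.2 hτ) (right_mem_Icc.2 hτ) hτ

/-- A lower bound for the velocity as long as the density stays bounded. -/
theorem le_deriv_of_density_le (h : IsFriedmannSolution c G Λ P a ρ (Icc 0 τ)) (hG : 0 < G)
    (hΛ : 0 < Λ) (hP : A0 c P) (hneg : ∀ t ∈ Icc 0 τ, deriv a t < 0) (hτ : 0 ≤ τ) {M : ℝ}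
    (hM : ∀ t ∈ Icc 0 τ, ρ t ≤ M) :
    deriv a 0 - 4 * π * G / 3 * (M + 3 * P M / c ^ 2) * a 0 * τ ≤ deriv a τ := by
  set K := 4 * π * G / 3 * (M + 3 * P M / c ^ 2) * a 0 with hK
  have h0 : (0 : ℝ) ∈ Icc 0 τ := left_mem_Icc.2 hτ
  have hMpos : 0 < M := (h 0 h0).2.1.trans_le (hM 0 h0)
  have hm : MonotoneOn (fun t => deriv a t + K * t) (Icc 0 τ) := by
    refine monotoneOn_Icc_of_hasDerivAt_nonneg
      (fun t ht => (h t ht).2.2.2.1.add ((hasDerivAt_id t).const_mul K)) fun t ht => ?_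
    have ht' := Ioo_subset_Icc_self ht
    obtain ⟨ha, hρ, -⟩ := h t ht'
    have ha0 : a t ≤ a 0 := h.antitoneOn_scale hneg h0 ht' ht.1.le
    have hPM : P (ρ t) ≤ P M := hP.monotoneOn_s14 hρ hMpos (hM t ht')
    have hPt := hP.2.1 _ hρ
    have hρM := hM t ht'
    have hKt : 4 * π * G / 3 * (ρ t + 3 * P (ρ t) / c ^ 2) * a t ≤ K := by
      rw [hK]
      have := hP.2.1 M hMpos
      gcongr
    have hΛt : 0 ≤ c ^ 2 * Λ / 3 * a t := by positivity
    linarith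
  have := hm h0 (right_mem_Icc.2 hτ) hτ
  simp only [mul_zero, add_zero] at this
  linarith

/-- A solution whose scale factor, velocity and density converge, with positive limits for the
scale factor and the density, can be continued. -/
theorem exists_extension {s T L v R : ℝ} (h : IsFriedmannSolution c G Λ P a ρ (Ioo s T))
    (hsT : s < T) (hP : A0 c P) (hL : 0 < L) (hR : 0 < R) (ha : Tendsto a (𝓝[<] T) (𝓝 L))
    (hv : Tendsto (deriv a) (𝓝[<] T) (𝓝 v)) (hρ : Tendsto ρ (𝓝[<] T) (𝓝 R)) :
    ∃ (b σ : ℝ → ℝ) (u : ℝ), T < u ∧ IsFriedmannSolution c G Λ P b σ (Ioo s u) ∧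
      (∀ t < T, b t = a t) ∧ ∀ t < T, σ t = ρ t := by
  let f : ℝ × ℝ × ℝ → ℝ × ℝ × ℝ := fun p =>
    (p.2.1, (-(4 * π * G / 3) * (p.2.2 + 3 * P p.2.2 / c ^ 2) + c ^ 2 * Λ / 3) * p.1,
      -3 * (p.2.2 + P p.2.2 / c ^ 2) * (p.2.1 / p.1))
  have hf : ContDiffAt ℝ 1 f (L, v, R) := by
    have h1 : ContDiffAt ℝ 1 (fun p : ℝ × ℝ × ℝ => p.1) (L, v, R) := contDiffAt_fst
    have h2 : ContDiffAt ℝ 1 (fun p : ℝ × ℝ × ℝ => p.2.1) (L, v, R) := by fun_prop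
    have h3 : ContDiffAt ℝ 1 (fun p : ℝ × ℝ × ℝ => p.2.2) (L, v, R) := by fun_prop
    have h4 : ContDiffAt ℝ 1 (fun p : ℝ × ℝ × ℝ => P p.2.2) (L, v, R) :=
      ContDiffAt.comp (L, v, R) (g := P)
        ((hP.1.contDiffAt (Ioi_mem_nhds hR)).of_le (by exact_mod_cast le_top)) h3
    refine h2.prodMk (ContDiffAt.prodMk ?_ ?_)
    · exact ((contDiffAt_const.mul (h3.add ((contDiffAt_const.mul h4).div_const _))).add
        contDiffAt_const).mul h1
    · exact (contDiffAt_const.mul (h3.add (h4.div_const _))).mul (h2.div h1 hL.ne')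
  have hU : {p : ℝ × ℝ × ℝ | 0 < p.1 ∧ 0 < p.2.2} ∈ 𝓝 (L, v, R) :=
    ((isOpen_lt continuous_const continuous_fst).inter
      (isOpen_lt continuous_const (continuous_snd.comp continuous_snd))).mem_nhds ⟨hL, hR⟩
  obtain ⟨w, u, hTu, hw, hwU, hwd⟩ := exists_hasDerivAt_extension
    (y := fun t => (a t, deriv a t, ρ t)) hsT
    (fun t ht => (h t ht).2.2.1.hasDerivAt.prodMk
      ((h t ht).2.2.2.1.prodMk (h t ht).2.2.2.2))
    (ha.prodMk_nhds (hv.prodMk_nhds hρ)) hf hU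
  have hd1 : ∀ t ∈ Ioo s u, HasDerivAt (fun t => (w t).1) (w t).2.1 t := fun t ht =>
    (hasFDerivAt_fst (𝕜 := ℝ) (p := w t)).comp_hasDerivAt t (hwd t ht)
  have hd2 : ∀ t ∈ Ioo s u, HasDerivAt (fun t => (w t).2) (f (w t)).2 t := fun t ht =>
    (hasFDerivAt_snd (𝕜 := ℝ) (p := w t)).comp_hasDerivAt t (hwd t ht)
  refine ⟨fun t => (w t).1, fun t => (w t).2.2, u, hTu, fun t ht => ?_,
    fun t ht => by simp [hw t ht], fun t ht => by simp [hw t ht]⟩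
  have hpos : 0 < (w t).1 ∧ 0 < (w t).2.2 := by
    rcases lt_or_ge t T with htT | htT
    · rw [hw t htT]
      exact ⟨(h t ⟨ht.1, htT⟩).1, (h t ⟨ht.1, htT⟩).2.1⟩
    · exact hwU t ⟨htT, ht.2⟩
  have hder : deriv (fun t => (w t).1) =ᶠ[𝓝 t] fun t => (w t).2.1 := by
    filter_upwards [Ioo_mem_nhds ht.1 ht.2] with x hx using (hd1 x hx).deriv
  refine ⟨hpos.1, hpos.2, (hd1 t ht).differentiableAt, ?_, ?_⟩
  · exact (hasFDerivAt_fst.comp_hasDerivAt t (hd2 t ht)).congr_of_eventuallyEq hder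
  · rw [hder.eq_of_nhds]
    exact hasFDerivAt_snd.comp_hasDerivAt t (hd2 t ht)

end IsFriedmannSolution

/-- Time-reversed Theorem 1 (Big Crunch): if `ȧ₀ < 0` and
`4πG(ρ₀ + 3P(ρ₀)/c²) ≥ c²Λ`, then `t₊` is finite and `a(t) → 0`, `ρ(t) → +∞`
as `t → t₊ - 0`. -/
theorem big_crunch
    (c G Λ : ℝ) (hc : 0 < c) (hG : 0 < G) (hΛ : 0 < Λ)
    (P : ℝ → ℝ) (hA0 : A0 c P)
    (a ρ : ℝ → ℝ) (tm tp : EReal)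
    (hmax : IsMaximalSolution c G Λ P a ρ tm tp)
    (a0 adot0 ρ0 : ℝ) (ha0 : a 0 = a0) (hadot0 : deriv a 0 = adot0) (hρ0 : ρ 0 = ρ0)
    (ha0pos : 0 < a0) (hρ0pos : 0 < ρ0) (hadot0neg : adot0 < 0)
    (hcond : c ^ 2 * Λ ≤ 4 * Real.pi * G * (ρ0 + 3 * P ρ0 / c ^ 2)) :
    ∃ T : ℝ, tp = (T : EReal) ∧
      Filter.Tendsto a (nhdsWithin T (Set.Iio T)) (nhds 0) ∧
      Filter.Tendsto ρ (nhdsWithin T (Set.Iio T)) Filter.atTop := by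
  subst ha0 hadot0 hρ0
  obtain ⟨htm, htp, hsol, hext⟩ := hmax
  have hIcc : ∀ τ : ℝ, (τ : EReal) < tp → IsFriedmannSolution c G Λ P a ρ (Icc 0 τ) :=
    fun τ hτ => hsol.mono_s14 fun t ht =>
      ⟨htm.trans_le (by exact_mod_cast ht.1), lt_of_le_of_lt (by exact_mod_cast ht.2) hτ⟩
  have hneg : ∀ τ : ℝ, (τ : EReal) < tp → ∀ t ∈ Icc 0 τ, deriv a t < 0 := fun τ hτ =>
    (hIcc τ hτ).deriv_neg hG hA0 hcond hadot0neg
  have hderiv : ∀ τ : ℝ, (τ : EReal) < tp → AntitoneOn (deriv a) (Icc 0 τ) := fun τ hτ =>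
    (hIcc τ hτ).antitoneOn_deriv hG hA0 hcond fun t ht => hneg τ hτ t (Ioo_subset_Icc_self ht)
  have hbound : tp ≤ ((a 0 / -deriv a 0 : ℝ) : EReal) := by
    by_contra! hlt
    have hτ : 0 ≤ a 0 / -deriv a 0 := div_nonneg ha0pos.le (neg_nonneg.2 hadot0neg.le)
    have h1 := (hIcc _ hlt).scale_le_s14
      (fun t ht => hderiv _ hlt (left_mem_Icc.2 hτ) ht ht.1) hτ
    have h2 := (hIcc _ hlt _ (right_mem_Icc.2 hτ)).1
    have h3 : deriv a 0 * (a 0 / -deriv a 0) = -a 0 := by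
      have := hadot0neg.ne
      field_simp
    linarith
  lift tp to ℝ using ⟨ne_top_of_le_ne_top (EReal.coe_ne_top _) hbound, (bot_le.trans_lt htp).ne'⟩
    with T
  replace htp : 0 < T := by exact_mod_cast htp
  simp only [EReal.coe_lt_coe_iff] at hIcc hneg hderiv
  have hmono : MonotoneOn ρ (Ioo 0 T) := fun x hx y hy hxy =>
    (hIcc y hy.2).monotoneOn_density hA0 (fun t ht => hneg y hy.2 t (Ioo_subset_Icc_self ht))
      ⟨hx.1.le, hxy⟩ ⟨hy.1.le, le_rfl⟩ hxy
  have hanti : AntitoneOn a (Ioo 0 T) := fun x hx y hy hxy =>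
    (hIcc y hy.2).antitoneOn_scale (hneg y hy.2) ⟨hx.1.le, hxy⟩ ⟨hy.1.le, le_rfl⟩ hxy
  have hanti' : AntitoneOn (deriv a) (Ioo 0 T) := fun x hx y hy hxy =>
    hderiv y hy.2 ⟨hx.1.le, hxy⟩ ⟨hy.1.le, le_rfl⟩ hxy
  have hpos : ∀ t, 0 ≤ t → t < T → 0 < a t ∧ 0 < ρ t := fun t h0 hT =>
    ⟨(hIcc t hT t ⟨h0, le_rfl⟩).1, (hIcc t hT t ⟨h0, le_rfl⟩).2.1⟩
  have hne : (Ioo 0 T).Nonempty := nonempty_Ioo.2 htp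
  have hmem : Ioo 0 T ∈ 𝓝[<] T := Ioo_mem_nhdsLT htp
  have hbdd : BddBelow (a '' Ioo 0 T) :=
    ⟨0, by rintro _ ⟨t, ht, rfl⟩; exact (hpos t ht.1.le ht.2).1.le⟩
  have halim := hanti.tendsto_nhdsWithin_Ioo_left hne hbdd
  set L := sInf (a '' Ioo 0 T) with hLdef
  have hLle : ∀ t ∈ Ioo 0 T, L ≤ a t := fun t ht => csInf_le hbdd (mem_image_of_mem a ht)
  have hL0 : 0 ≤ L := ge_of_tendsto halim (by
    filter_upwards [hmem] with t ht using (hpos t ht.1.le ht.2).1.le)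
  have hLzero : L = 0 := by
    by_contra hL
    replace hL : 0 < L := lt_of_le_of_ne hL0 (Ne.symm hL)
    set M := max (ρ 0) (ρ 0 * a 0 ^ 6 / L ^ 6)
    have hM : ∀ t, 0 ≤ t → t < T → ρ t ≤ M := fun t h0 hT => by
      rcases h0.eq_or_lt with rfl | h0'
      · exact le_max_left _ _
      · refine le_trans ?_ (le_max_right _ _)
        rw [le_div_iff₀ (by positivity)]
        refine le_trans ?_ ((hIcc t hT).density_mul_pow_six_le hc hA0 (hneg t hT) h0)
        exact mul_le_mul_of_nonneg_left (pow_le_pow_left₀ hL0 (hLle t ⟨h0', hT⟩) 6)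
          (hpos t h0 hT).2.le
    have hMpos : 0 < M := hρ0pos.trans_le (le_max_left _ _)
    have hρlim := hmono.tendsto_nhdsWithin_Ioo_left hne
      ⟨M, by rintro _ ⟨t, ht, rfl⟩; exact hM t ht.1.le ht.2⟩
    have hvlim := hanti'.tendsto_nhdsWithin_Ioo_left hne
      ⟨deriv a 0 - 4 * π * G / 3 * (M + 3 * P M / c ^ 2) * a 0 * T, by
        rintro _ ⟨t, ht, rfl⟩
        refine le_trans ?_ ((hIcc t ht.2).le_deriv_of_density_le hG hΛ hA0 (hneg t ht.2)
          ht.1.le fun x hx => hM x hx.1 (hx.2.trans_lt ht.2))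
        have := hA0.2.1 M hMpos
        have := ht.2.le
        gcongr⟩
    have hR : 0 < sSup (ρ '' Ioo 0 T) := hρ0pos.trans_le (ge_of_tendsto hρlim (by
      filter_upwards [hmem] with t ht
      exact (hIcc t ht.2).monotoneOn_density hA0
        (fun x hx => hneg t ht.2 x (Ioo_subset_Icc_self hx)) ⟨le_rfl, ht.1.le⟩
        ⟨ht.1.le, le_rfl⟩ ht.1.le))
    obtain ⟨s, hs, hs0⟩ := EReal.lt_iff_exists_real_btwn.1 htm
    replace hs0 : s < 0 := by exact_mod_cast hs0
    obtain ⟨b, σ, u, hTu, hsol', hb, hσ⟩ := (hsol.mono_s14 (J := Ioo s T) fun t ht =>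
      ⟨hs.trans (by exact_mod_cast ht.1), by exact_mod_cast ht.2⟩).exists_extension
      (hs0.trans htp) hA0 hL hR halim hvlim hρlim
    have hba : b =ᶠ[𝓝 0] a := by
      filter_upwards [Iio_mem_nhds htp] with x hx using hb x hx
    have := (hext b σ s u hs0 (htp.trans hTu) hsol' (hb 0 htp) hba.deriv_eq (hσ 0 htp)).2
    exact hTu.not_ge (by exact_mod_cast this)
  rw [hLzero] at halim
  refine ⟨T, rfl, halim, ?_⟩
  have hcube : Tendsto (fun t => a t ^ 3) (𝓝[<] T) (𝓝[>] 0) := by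
    refine tendsto_nhdsWithin_iff.2 ⟨by simpa using halim.pow 3, ?_⟩
    filter_upwards [hmem] with t ht using pow_pos (hpos t ht.1.le ht.2).1 3
  refine tendsto_atTop_mono' _ ?_
    (hcube.inv_tendsto_nhdsGT_zero.const_mul_atTop (show 0 < ρ 0 * a 0 ^ 3 by positivity))
  filter_upwards [hmem] with t ht
  have := pow_pos (hpos t ht.1.le ht.2).1 3
  simp only [Pi.inv_apply]
  rw [← div_eq_mul_inv, div_le_iff₀ this]
  exact (hIcc t ht.2).density_mul_cube_le hA0 (hneg t ht.2) ht.1.le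
end
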